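/- arXiv:1311.5878 — 4 statements merged into one kernel-verified Lean document; each statement's English description precedes it below -/
import Mathlib

section
/- Let (X, Y, π) be an irreducible factor triple with π infinite-to-one, and let y ∈ Y be right transitive. Then every transition class over y is uncountable. -/
open Set

universe u v uc

variable {A : Type u} {B : Type v}

/-- The shift by `n` on points of the full shift `ℤ → A`. -/
def shiftMap (n : ℤ) (x : ℤ → A) : ℤ → A := fun i => x (i + n)

/-- A subshift: a closed, shift-invariant subset of the full shift. -/
def IsSubshift [TopologicalSpace A] (X : Set (ℤ → A)) : Prop :=
  IsClosed X ∧ ∀ n : ℤ, ∀ x ∈ X, shiftMap n x ∈ X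

/-- The block `u` (of length `p`) occurs in `X`. -/
def OccursIn {p : ℕ} (u : Fin p → A) (X : Set (ℤ → A)) : Prop :=
  ∃ x ∈ X, ∃ i : ℤ, ∀ j : Fin p, x (i + (j.1 : ℤ)) = u j

/-- A shift of finite type: a subshift determined by a set of allowed `k`-blocks. -/
def IsSFT [TopologicalSpace A] (X : Set (ℤ → A)) : Prop :=
  IsSubshift X ∧ ∃ (k : ℕ) (P : (Fin k → A) → Prop),
    X = {x | ∀ i : ℤ, P fun j => x (i + (j.1 : ℤ))}

/-- A one-step shift of finite type: determined by allowed 2-blocks. -/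
def IsOneStep [TopologicalSpace A] (X : Set (ℤ → A)) : Prop :=
  IsSubshift X ∧ ∃ T : A → A → Prop, X = {x | ∀ i : ℤ, T (x i) (x (i + 1))}

/-- Irreducibility: any two blocks of `X` can be seen in a single point of `X`,
the second occurring after the first. -/
def IrreducibleSubshift [TopologicalSpace A] (X : Set (ℤ → A)) : Prop :=
  ∀ (p q : ℕ) (u : Fin p → A) (w : Fin q → A),
    OccursIn u X → OccursIn w X →
      ∃ x ∈ X, ∃ i k : ℤ, i + (p : ℤ) ≤ k ∧
        (∀ j : Fin p, x (i + (j.1 : ℤ)) = u j) ∧ ∀ j : Fin q, x (k + (j.1 : ℤ)) = w j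

/-- A sliding block code: given by a local rule on a finite window. -/
def IsSlidingBlockCode (π : (ℤ → A) → ℤ → B) : Prop :=
  ∃ (r : ℕ) (Φ : (Fin (2 * r + 1) → A) → B),
    ∀ x i, π x i = Φ fun j => x (i - (r : ℤ) + (j.1 : ℤ))

/-- A one-block code. -/
def IsOneBlock (π : (ℤ → A) → ℤ → B) : Prop :=
  ∃ Φ : A → B, ∀ x i, π x i = Φ (x i)

/-- `Φ` is a one-block local rule for `π`. -/
def OneBlockRule (π : (ℤ → A) → ℤ → B) (Φ : A → B) : Prop :=
  ∀ x i, π x i = Φ (x i)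

/-- A factor code from `X` onto `Y`. -/
def IsFactorCode (X : Set (ℤ → A)) (Y : Set (ℤ → B)) (π : (ℤ → A) → ℤ → B) : Prop :=
  IsSlidingBlockCode π ∧ (∀ x ∈ X, π x ∈ Y) ∧ ∀ y ∈ Y, ∃ x ∈ X, π x = y

/-- A factor triple: a factor code from an SFT `X` onto the subshift `Y`. -/
def FactorTriple [TopologicalSpace A] [TopologicalSpace B]
    (X : Set (ℤ → A)) (Y : Set (ℤ → B)) (π : (ℤ → A) → ℤ → B) : Prop :=
  IsSFT X ∧ IsSubshift Y ∧ IsFactorCode X Y π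

/-- Transition `x → x'`: for each `n` there is `z` in the fiber agreeing with `x`
on `(-∞, n]` and with `x'` on `[i, ∞)` for some `i ≥ n`. -/
def TransitionTo (X : Set (ℤ → A)) (π : (ℤ → A) → ℤ → B) (x x' : ℤ → A) : Prop :=
  ∀ n : ℤ, ∃ z ∈ X, π z = π x ∧ (∀ m ≤ n, z m = x m) ∧
    ∃ i : ℤ, n ≤ i ∧ ∀ m : ℤ, i ≤ m → z m = x' m

/-- `x ~ x'`: transitions in both directions. -/
def TransEquiv (X : Set (ℤ → A)) (π : (ℤ → A) → ℤ → B) (x x' : ℤ → A) : Prop :=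
  TransitionTo X π x x' ∧ TransitionTo X π x' x

/-- The transition class of `x` (within the fiber of `π x`). -/
def transClass (X : Set (ℤ → A)) (π : (ℤ → A) → ℤ → B) (x : ℤ → A) : Set (ℤ → A) :=
  {x' | x' ∈ X ∧ π x' = π x ∧ TransEquiv X π x x'}

/-- The set of transition classes over `y`. -/
def transClassesOver (X : Set (ℤ → A)) (π : (ℤ → A) → ℤ → B) (y : ℤ → B) :
    Set (Set (ℤ → A)) :=
  {C | ∃ x, x ∈ X ∧ π x = y ∧ C = transClass X π x}

/-- Right transitive point: its forward orbit is dense in `X`. -/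
def RightTransitive (X : Set (ℤ → A)) (x : ℤ → A) : Prop :=
  x ∈ X ∧ ∀ z ∈ X, ∀ N : ℕ, ∃ n : ℤ, 0 ≤ n ∧ ∀ m : ℤ, |m| ≤ (N : ℤ) → x (m + n) = z m

/-- Left transitive point: its backward orbit is dense in `X`. -/
def LeftTransitive (X : Set (ℤ → A)) (x : ℤ → A) : Prop :=
  x ∈ X ∧ ∀ z ∈ X, ∀ N : ℕ, ∃ n : ℤ, n ≤ 0 ∧ ∀ m : ℤ, |m| ≤ (N : ℤ) → x (m + n) = z m

/-- Doubly transitive point. -/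
def DoublyTransitive (X : Set (ℤ → A)) (x : ℤ → A) : Prop :=
  RightTransitive X x ∧ LeftTransitive X x

def MutuallySeparated (x x' : ℤ → A) : Prop := ∀ i : ℤ, x i ≠ x' i

def RightAsymptotic (x x' : ℤ → A) : Prop := ∃ N : ℤ, ∀ m : ℤ, N ≤ m → x m = x' m

def LeftAsymptotic (x x' : ℤ → A) : Prop := ∃ N : ℤ, ∀ m : ℤ, m ≤ N → x m = x' m

/-- The class degree: the minimal number of transition classes over points of `Y`. -/
noncomputable def classDegree (X : Set (ℤ → A)) (Y : Set (ℤ → B))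
    (π : (ℤ → A) → ℤ → B) : ℕ :=
  sInf {d | ∃ y ∈ Y, Nat.card (transClassesOver X π y) = d}

/-- The preimage blocks of a `Y`-block `w` under the one-block rule `Φ`. -/
def blockPre (X : Set (ℤ → A)) (Φ : A → B) {p : ℕ} (w : Fin p → B) : Set (Fin p → A) :=
  {u | OccursIn u X ∧ ∀ j, Φ (u j) = w j}

/-- `u ∈ π⁻¹(w)` is routable through `a` at time `n`. -/
def Routable (X : Set (ℤ → A)) (Φ : A → B) {p : ℕ} (w : Fin (p + 1) → B)
    (u : Fin (p + 1) → A) (n : Fin (p + 1)) (a : A) : Prop :=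
  ∃ u' ∈ blockPre X Φ w, u' 0 = u 0 ∧ u' (Fin.last p) = u (Fin.last p) ∧ u' n = a

/-- `(w, n, M)` is a transition block. -/
def IsTransBlock (X : Set (ℤ → A)) (Y : Set (ℤ → B)) (Φ : A → B) {p : ℕ}
    (w : Fin (p + 1) → B) (n : Fin (p + 1)) (M : Set A) : Prop :=
  OccursIn w Y ∧ 0 < n.1 ∧ n.1 < p ∧ (∀ a ∈ M, Φ a = w n) ∧
    ∀ u ∈ blockPre X Φ w, ∃ a ∈ M, Routable X Φ w u n a

/-- `c*_π`: the minimal depth of a transition block. -/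
noncomputable def minDepth (X : Set (ℤ → A)) (Y : Set (ℤ → B)) (Φ : A → B) : ℕ :=
  sInf {d | ∃ (p : ℕ) (w : Fin (p + 1) → B) (n : Fin (p + 1)) (M : Set A),
    IsTransBlock X Y Φ w n M ∧ Nat.card M = d}

/-- A minimal transition block. -/
def IsMinTransBlock (X : Set (ℤ → A)) (Y : Set (ℤ → B)) (Φ : A → B) {p : ℕ}
    (w : Fin (p + 1) → B) (n : Fin (p + 1)) (M : Set A) : Prop :=
  IsTransBlock X Y Φ w n M ∧ Nat.card M = minDepth X Y Φ

/-- `d(w)`: the minimal number of symbols seen at a single coordinate among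
the preimages of `w`. -/
noncomputable def dval (X : Set (ℤ → A)) (Φ : A → B) {p : ℕ} (w : Fin p → B) : ℕ :=
  sInf {m | ∃ k : Fin p, Nat.card {a : A | ∃ u ∈ blockPre X Φ w, u k = a} = m}

/-- A magic block: a block of `Y` minimizing `d(·)`. -/
def IsMagicBlock (X : Set (ℤ → A)) (Y : Set (ℤ → B)) (Φ : A → B) {p : ℕ}
    (w : Fin (p + 1) → B) : Prop :=
  OccursIn w Y ∧
    dval X Φ w = sInf {m | ∃ (q : ℕ) (v : Fin (q + 1) → B), OccursIn v Y ∧ dval X Φ v = m}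

/-- An `(X̄, v̄)`-diamond: blocks `u, v` of `X` with the same image, same
endpoints, `u` occurring in `X̄` and `v̄` a subblock of `v`. -/
def IsDiamond (X Xbar : Set (ℤ → A)) (Φ : A → B) {q p : ℕ} (vbar : Fin q → A)
    (u v : Fin (p + 1) → A) : Prop :=
  OccursIn u Xbar ∧ OccursIn v X ∧ (∀ j, Φ (u j) = Φ (v j)) ∧
    (∃ (s : ℕ) (_ : s + q ≤ p + 1), ∀ j : Fin q,
      v ⟨s + j.1, by have := j.2; omega⟩ = vbar j) ∧
    u 0 = v 0 ∧ u (Fin.last p) = v (Fin.last p)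

/-- Reversed transition `x →_r x'`. -/
def RevTransitionTo (X : Set (ℤ → A)) (π : (ℤ → A) → ℤ → B) (x x' : ℤ → A) : Prop :=
  ∀ n : ℤ, ∃ z ∈ X, π z = π x ∧ (∀ m : ℤ, n ≤ m → z m = x' m) ∧
    ∃ i : ℤ, i ≤ n ∧ ∀ m ≤ i, z m = x m

def RevTransEquiv (X : Set (ℤ → A)) (π : (ℤ → A) → ℤ → B) (x x' : ℤ → A) : Prop :=
  RevTransitionTo X π x x' ∧ RevTransitionTo X π x' x

/-- The reversed transition class of `x`. -/
def revClass (X : Set (ℤ → A)) (π : (ℤ → A) → ℤ → B) (x : ℤ → A) : Set (ℤ → A) :=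
  {x' | x' ∈ X ∧ π x' = π x ∧ RevTransEquiv X π x x'}

open scoped Classical in
/-- The standard metric on the full shift. -/
noncomputable def shiftDist (x x' : ℤ → A) : ℝ :=
  if x = x' then 0
  else
    let k : ℕ := sInf {k : ℕ | x (k : ℤ) ≠ x' (k : ℤ) ∨ x (-(k : ℤ)) ≠ x' (-(k : ℤ))}
    (2 : ℝ) ^ (-(k : ℤ))

set_option linter.unusedSectionVars false

/-- Truncated counting semiring `{0, 1, ≥2}`. -/
def S3 : Type := Fin 3

namespace S3

instance : DecidableEq S3 := inferInstanceAs (DecidableEq (Fin 3))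
instance : Fintype S3 := inferInstanceAs (Fintype (Fin 3))
def ofN (n : ℕ) : S3 := (⟨min n 2, by omega⟩ : Fin 3)
def toN (a : S3) : ℕ := Fin.val (n := 3) a

instance : Zero S3 := ⟨ofN 0⟩
instance : One S3 := ⟨ofN 1⟩
instance : Add S3 := ⟨fun a b => ofN (a.toN + b.toN)⟩
instance : Mul S3 := ⟨fun a b => ofN (a.toN * b.toN)⟩

instance : CommSemiring S3 where
  add_assoc := by decide
  zero_add := by decide
  add_zero := by decide
  add_comm := by decide
  left_distrib := by decide
  right_distrib := by decide
  zero_mul := by decide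
  mul_zero := by decide
  mul_assoc := by decide
  one_mul := by decide
  mul_one := by decide
  mul_comm := by decide
  nsmul := nsmulRec

def two : S3 := ofN 2

lemma cases' : ∀ a : S3, a = 0 ∨ a = 1 ∨ a = two := by decide
lemma one_nz : (1 : S3) ≠ 0 := by decide
lemma two_ne_zero' : two ≠ 0 := by decide
lemma two_ne_one' : two ≠ 1 := by decide
lemma add_ne : ∀ a b : S3, a + b ≠ 0 ↔ a ≠ 0 ∨ b ≠ 0 := by decide
lemma mul_ne : ∀ a b : S3, a * b ≠ 0 ↔ a ≠ 0 ∧ b ≠ 0 := by decide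
lemma add_two : ∀ a b : S3, a + b = two ↔ a = two ∨ b = two ∨ (a ≠ 0 ∧ b ≠ 0) := by decide
lemma add_one : ∀ a b : S3, a + b = 1 → a = 1 ∨ b = 1 := by decide
lemma mul_one' : ∀ a b : S3, a * b = 1 → a = 1 ∧ b = 1 := by decide
lemma mul_two_left : ∀ b : S3, b ≠ 0 → two * b = two := by decide
lemma mul_two_right : ∀ b : S3, b ≠ 0 → b * two = two := by decide

variable {ι : Type*}

lemma sum_ne (s : Finset ι) (f : ι → S3) : ∑ i ∈ s, f i ≠ 0 ↔ ∃ i ∈ s, f i ≠ 0 := by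
  classical
  induction s using Finset.induction_on with
  | empty => simp
  | insert a s ha ih => rw [Finset.sum_insert ha, add_ne, ih]; simp

lemma sum_one (s : Finset ι) (f : ι → S3) : ∑ i ∈ s, f i = 1 → ∃ i ∈ s, f i = 1 := by
  classical
  induction s using Finset.induction_on with
  | empty => intro h; rw [Finset.sum_empty] at h; exact absurd h.symm one_nz
  | insert a s ha ih =>
    rw [Finset.sum_insert ha]
    intro h
    rcases add_one _ _ h with h | h
    · exact ⟨a, by simp, h⟩
    · obtain ⟨i, hi, h⟩ := ih h
      exact ⟨i, by simp [hi], h⟩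

lemma sum_two (s : Finset ι) (f : ι → S3) : ∑ i ∈ s, f i = two ↔
    (∃ i ∈ s, f i = two) ∨ ∃ i ∈ s, ∃ j ∈ s, i ≠ j ∧ f i ≠ 0 ∧ f j ≠ 0 := by
  classical
  induction s using Finset.induction_on with
  | empty => simp; decide
  | insert a s ha ih =>
    rw [Finset.sum_insert ha, add_two, ih, sum_ne]
    constructor
    · rintro (h | (⟨i, hi, h⟩ | ⟨i, hi, j, hj, h⟩) | ⟨h, i, hi, h'⟩)
      · exact Or.inl ⟨a, by simp, h⟩
      · exact Or.inl ⟨i, by simp [hi], h⟩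
      · exact Or.inr ⟨i, by simp [hi], j, by simp [hj], h⟩
      · exact Or.inr ⟨a, by simp, i, by simp [hi], by rintro rfl; exact ha hi, h, h'⟩
    · rintro (⟨i, hi, h⟩ | ⟨i, hi, j, hj, hij, h, h'⟩)
      · rcases Finset.mem_insert.1 hi with rfl | hi
        · exact Or.inl h
        · exact Or.inr (Or.inl (Or.inl ⟨i, hi, h⟩))
      · rcases Finset.mem_insert.1 hi with rfl | hi <;> rcases Finset.mem_insert.1 hj with rfl | hj
        · exact absurd rfl hij
        · exact Or.inr (Or.inr ⟨h, j, hj, h'⟩)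
        · exact Or.inr (Or.inr ⟨h', i, by assumption, h⟩)
        · exact Or.inr (Or.inl (Or.inr ⟨i, hi, j, hj, hij, h, h'⟩))

end S3

section Mat

open S3

variable {V : Type*} [Fintype V] [DecidableEq V]

lemma mat_ne {m n : Matrix V V S3} {a b c : V} (h : m a b ≠ 0) (h' : n b c ≠ 0) :
    (m * n) a c ≠ 0 := by
  rw [Matrix.mul_apply, sum_ne]
  exact ⟨b, Finset.mem_univ _, (mul_ne _ _).2 ⟨h, h'⟩⟩

lemma mat_two_left {m n : Matrix V V S3} {a b c : V} (h : m a b = two) (h' : n b c ≠ 0) :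
    (m * n) a c = two := by
  rw [Matrix.mul_apply, sum_two]
  exact Or.inl ⟨b, Finset.mem_univ _, by rw [h, mul_two_left _ h']⟩

lemma mat_two_right {m n : Matrix V V S3} {a b c : V} (h : m a b ≠ 0) (h' : n b c = two) :
    (m * n) a c = two := by
  rw [Matrix.mul_apply, sum_two]
  exact Or.inl ⟨b, Finset.mem_univ _, by rw [h', mul_two_right _ h]⟩

lemma mat_one {m n : Matrix V V S3} {a c : V} (h : (m * n) a c = 1) :
    ∃ b, m a b = 1 ∧ n b c = 1 := by
  rw [Matrix.mul_apply] at h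
  obtain ⟨b, -, h⟩ := sum_one _ _ h
  exact ⟨b, mul_one' _ _ h⟩

lemma mat_ne_zero {m : Matrix V V S3} {a b : V} (h : m a b ≠ 0) : m ≠ 0 := by
  rintro rfl; exact h rfl

lemma mat_exists {m : Matrix V V S3} (h : m ≠ 0) : ∃ a b, m a b ≠ 0 := by
  by_contra! h'
  exact h (by ext a b; exact h' a b)

lemma exists_pow_rep {M : Type*} [Monoid M] [Finite M] (h : M) :
    ∃ i k : ℕ, 1 ≤ k ∧ h ^ (i + k) = h ^ i := by
  obtain ⟨i, j, hij, h'⟩ := Finite.exists_ne_map_eq_of_infinite (fun n : ℕ => h ^ n)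
  rcases lt_or_gt_of_ne hij with hl | hl
  · exact ⟨i, j - i, by omega, by rw [Nat.add_sub_cancel' hl.le]; exact h'.symm⟩
  · exact ⟨j, i - j, by omega, by rw [Nat.add_sub_cancel' hl.le]; exact h'⟩

lemma exists_pow_idem {M : Type*} [Monoid M] [Finite M] (h : M) :
    ∃ n : ℕ, 1 ≤ n ∧ h ^ n * h ^ n = h ^ n := by
  obtain ⟨i, k, hk, hp⟩ := exists_pow_rep h
  have h1 : ∀ m j, i ≤ m → h ^ (m + j * k) = h ^ m := by
    intro m j hm
    induction j with
    | zero => simp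
    | succ j ih =>
      have : m + (j + 1) * k = (m - i) + (j * k) + (i + k) := by
        have : m = (m - i) + i := by omega
        rw [add_mul]; omega
      rw [this, pow_add, hp, ← pow_add, ← ih]
      congr 1; omega
  refine ⟨(i + 1) * k, by nlinarith, ?_⟩
  rw [← pow_add]
  exact h1 _ _ (by nlinarith)

theorem exists_no_one [Nonempty V] (S : Submonoid (Matrix V V S3))
    (irr : ∀ a b, ∃ m ∈ S, m a b ≠ 0) (dia : ∃ a b, ∃ m ∈ S, m a b = two) :
    ∃ m ∈ S, m ≠ 0 ∧ ∀ a b, m a b ≠ 1 := by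
  classical
  let I : Matrix V V S3 → Set (Matrix V V S3) := fun T => (fun s => s * T) '' (S : Set _)
  let f : Matrix V V S3 → ℕ := fun T => (I T).ncard
  have hne : ∃ d, ∃ T ∈ S, T ≠ 0 ∧ f T = d := by
    obtain ⟨a⟩ := ‹Nonempty V›
    obtain ⟨m, hm, h⟩ := irr a a
    exact ⟨_, m, hm, mat_ne_zero h, rfl⟩
  obtain ⟨T, hTS, hT0, hTf⟩ := Nat.find_spec hne
  have hmin : ∀ T' ∈ S, T' ≠ 0 → f T ≤ f T' := by
    intro T' h1 h2
    rw [hTf]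
    exact Nat.find_min' hne ⟨T', h1, h2, rfl⟩
  have hI : ∀ s ∈ S, ∀ T', I (s * T') ⊆ I T' := by
    rintro s hs T' _ ⟨t, ht, rfl⟩
    exact ⟨t * s, S.mul_mem ht hs, by simp [mul_assoc]⟩
  have left : ∀ T' ∈ S, f T' ≤ f T → ∀ s ∈ S, s * T' ≠ 0 → ∃ s' ∈ S, s' * (s * T') = T' := by
    intro T' hT' hle s hs h0
    have : I (s * T') = I T' := by
      apply Set.eq_of_subset_of_ncard_le (hI s hs T') _ (Set.toFinite _)
      exact hle.trans (hmin _ (S.mul_mem hs hT') h0)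
    have h1 : T' ∈ I T' := ⟨1, S.one_mem, by simp⟩
    rw [← this] at h1
    exact h1
  obtain ⟨a0, b0, hab⟩ := mat_exists hT0
  obtain ⟨v0, hv0, hv0'⟩ := irr b0 a0
  have h0 : (T * v0) * T ≠ 0 := mat_ne_zero (mat_ne (mat_ne hab hv0') hab)
  obtain ⟨s1, hs1, hs1'⟩ := left T hTS le_rfl _ (S.mul_mem hTS hv0) h0
  set h := s1 * (T * v0) with hh
  have hS : h ∈ S := S.mul_mem hs1 (S.mul_mem hTS hv0)
  have hhT : h * T = T := by rw [hh, mul_assoc, hs1']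
  obtain ⟨n, hn, hidem⟩ := exists_pow_idem h
  have hpT : ∀ n, h ^ n * T = T := by
    intro n
    induction n with
    | zero => simp
    | succ n ih => rw [pow_succ, mul_assoc, hhT, ih]
  set e := h ^ n with he
  have heS : e ∈ S := S.pow_mem hS n
  have he0 : e ≠ 0 := by
    intro h0
    have := hpT n
    rw [← he, h0, zero_mul] at this
    exact hT0 this.symm
  have hef : f e ≤ f T := by
    have e1 : e = (h ^ (n - 1) * s1) * (T * v0) := by
      rw [mul_assoc, ← hh, ← pow_succ, Nat.sub_add_cancel hn]
    have h1 : I e ⊆ (fun m => m * v0) '' I T := by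
      rw [e1]
      refine (hI _ (S.mul_mem (S.pow_mem hS _) hs1) _).trans ?_
      rintro _ ⟨s, hs, rfl⟩
      exact ⟨s * T, ⟨s, hs, rfl⟩, by simp [mul_assoc]⟩
    exact (Set.ncard_le_ncard h1 (Set.toFinite _)).trans (Set.ncard_image_le (Set.toFinite _))
  refine ⟨e, heS, he0, fun a b hab => ?_⟩
  -- find c with e c c = 1
  have step : ∀ c : {c // e c b = 1}, ∃ d : {c // e c b = 1}, e c.1 d.1 = 1 := by
    rintro ⟨c, hc⟩
    have hc' := hc
    rw [← hidem] at hc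
    obtain ⟨d, h1, h2⟩ := mat_one hc
    exact ⟨⟨d, h2⟩, h1⟩
  choose g hg using step
  let sq : ℕ → {c // e c b = 1} := fun i => g^[i] ⟨a, hab⟩
  have hsq : ∀ i, e (sq i).1 (sq (i + 1)).1 = 1 := by
    intro i
    simp only [sq, Function.iterate_succ_apply']
    exact hg _
  have hsq2 : ∀ i k, e (sq i).1 (sq (i + k + 1)).1 ≠ 0 := by
    intro i k
    induction k with
    | zero => rw [Nat.add_zero, hsq]; exact one_nz
    | succ k ih =>
      have hx : (e * e) (sq i).1 (sq (i + (k + 1) + 1)).1 ≠ 0 := ?_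
      · rwa [hidem] at hx
      refine mat_ne ih ?_
      rw [show i + (k + 1) + 1 = (i + k + 1) + 1 by ring, hsq]; exact one_nz
  obtain ⟨i, j, hij, hs⟩ := Finite.exists_ne_map_eq_of_infinite sq
  have hcc : ∃ c : {c // e c b = 1}, e c.1 c.1 ≠ 0 := by
    rcases lt_or_gt_of_ne hij with hl | hl
    · refine ⟨sq i, ?_⟩
      have := hsq2 i (j - i - 1)
      rwa [show i + (j - i - 1) + 1 = j by omega, ← hs] at this
    · refine ⟨sq j, ?_⟩
      have := hsq2 j (i - j - 1)
      rwa [show j + (i - j - 1) + 1 = i by omega, hs] at this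
  obtain ⟨⟨c, hcb⟩, hcc⟩ := hcc
  simp only at hcc
  have hc1 : e c c = 1 := by
    rcases cases' (e c c) with h | h | h
    · exact absurd h hcc
    · exact h
    · have : (e * e) c b = two := mat_two_left h (by rw [hcb]; exact one_nz)
      rw [hidem, hcb] at this
      exact absurd this.symm two_ne_one'
  obtain ⟨p, q, m, hm, hmpq⟩ := dia
  obtain ⟨m1, hm1, hm1'⟩ := irr c p
  obtain ⟨m2, hm2, hm2'⟩ := irr q c
  set v := m1 * m * m2 with hv
  have hvS : v ∈ S := S.mul_mem (S.mul_mem hm1 hm) hm2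
  have hvcc : v c c = two := mat_two_left (mat_two_right hm1' hmpq) hm2'
  set G := e * v * e with hG
  have hGcc : G c c = two := mat_two_left (mat_two_right hcc hvcc) hcc
  obtain ⟨s2, hs2, hs2'⟩ := left e heS hef (e * v) (S.mul_mem heS hvS)
    (mat_ne_zero (a := c) (b := c) (by rw [← hG, hGcc]; exact two_ne_zero'))
  rw [← hG] at hs2'
  have heG : e * G = G := by rw [hG, ← mul_assoc, ← mul_assoc, hidem]
  have hGe : G * e = G := by rw [hG, mul_assoc, hidem]
  have hcomm : ∀ k, e * G ^ k = G ^ k * e := fun k =>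
    (Commute.pow_right (show Commute e G from heG.trans hGe.symm) k)
  have hinv : ∀ k, s2 ^ k * G ^ k * e = e := by
    intro k
    induction k with
    | zero => simp
    | succ k ih =>
      calc s2 ^ (k + 1) * G ^ (k + 1) * e = s2 ^ k * (s2 * G) * G ^ k * e := by
            rw [pow_succ, pow_succ' G]; simp only [mul_assoc]
        _ = s2 ^ k * (e * G ^ k) * e := by rw [hs2']; simp only [mul_assoc]
        _ = s2 ^ k * G ^ k * (e * e) := by rw [hcomm]; simp only [mul_assoc]
        _ = e := by rw [hidem, ih]
  have hGk : ∀ k, (G ^ (k + 1)) c c = two := by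
    intro k
    induction k with
    | zero => simpa using hGcc
    | succ k ih => rw [pow_succ]; exact mat_two_left ih (by rw [hGcc]; exact two_ne_zero')
  obtain ⟨i, k, hk, hp⟩ := exists_pow_rep G
  have : e = e * G ^ k := by
    calc e = s2 ^ i * G ^ i * e := (hinv i).symm
      _ = s2 ^ i * (G ^ i * G ^ k) * e := by rw [← pow_add, hp]
      _ = s2 ^ i * G ^ i * (G ^ k * e) := by simp only [mul_assoc]
      _ = s2 ^ i * G ^ i * e * G ^ k := by rw [← hcomm]; simp only [mul_assoc]
      _ = e * G ^ k := by rw [hinv]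
  have h2 : (e * G ^ k) c c = two := mat_two_right hcc (by
    have := hGk (k - 1); rwa [Nat.sub_add_cancel hk] at this)
  rw [← this, hc1] at h2
  exact two_ne_one' h2.symm

end Mat

section Paths

open S3

variable {V : Type*} {W : Type*} [Fintype V] [DecidableEq V]

/-- `s` follows edges of `T` and reads the word `w`. -/
def Pth (T : V → V → Prop) (L : V → W) : List W → (ℕ → V) → Prop
  | [], _ => True
  | c :: w, s => L (s 0) = c ∧ T (s 0) (s 1) ∧ Pth T L w (fun i => s (i + 1))

open scoped Classical in
noncomputable def letterMat (T : V → V → Prop) (L : V → W) (c : W) : Matrix V V S3 :=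
  fun a b => if L a = c ∧ T a b then 1 else 0

noncomputable def wordMat (T : V → V → Prop) (L : V → W) (w : List W) : Matrix V V S3 :=
  (w.map (letterMat T L)).prod

def consSeq (a : V) (s : ℕ → V) : ℕ → V
  | 0 => a
  | n + 1 => s n

lemma letter_ne {T : V → V → Prop} {L : V → W} {c : W} {a b : V} :
    letterMat T L c a b ≠ 0 ↔ L a = c ∧ T a b := by
  unfold letterMat
  split_ifs with h
  · simp [h, one_nz]
  · simp [h]

lemma letter_ne_two {T : V → V → Prop} {L : V → W} {c : W} {a b : V} :
    letterMat T L c a b ≠ two := by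
  unfold letterMat
  split_ifs with h <;> decide

lemma wordMat_cons (T : V → V → Prop) (L : V → W) (c : W) (w : List W) :
    wordMat T L (c :: w) = letterMat T L c * wordMat T L w := by
  simp [wordMat]

lemma wordMat_append (T : V → V → Prop) (L : V → W) (w w' : List W) :
    wordMat T L (w ++ w') = wordMat T L w * wordMat T L w' := by
  simp [wordMat]

lemma word_ne (T : V → V → Prop) (L : V → W) (w : List W) : ∀ a b : V,
    wordMat T L w a b ≠ 0 ↔ ∃ s, s 0 = a ∧ s w.length = b ∧ Pth T L w s := by
  induction w with
  | nil =>
    intro a b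
    by_cases h : a = b
    · subst h
      simp only [wordMat, List.map_nil, List.prod_nil, Matrix.one_apply_eq]
      exact ⟨fun _ => ⟨fun _ => a, rfl, rfl, trivial⟩, fun _ => one_nz⟩
    · simp only [wordMat, List.map_nil, List.prod_nil, Matrix.one_apply_ne h]
      constructor
      · intro h; exact absurd rfl h
      · rintro ⟨s, h1, h2, -⟩; exact absurd (h1.symm.trans h2) h
  | cons c w ih =>
    intro a b
    rw [wordMat_cons, Matrix.mul_apply, sum_ne]
    constructor
    · rintro ⟨d, -, h⟩
      rw [mul_ne, letter_ne, ih] at h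
      obtain ⟨⟨h1, h2⟩, s, rfl, h4, h5⟩ := h
      exact ⟨consSeq a s, rfl, h4, h1, h2, h5⟩
    · rintro ⟨s, rfl, h2, h3, h4, h5⟩
      refine ⟨s 1, Finset.mem_univ _, ?_⟩
      rw [mul_ne, letter_ne, ih]
      exact ⟨⟨h3, h4⟩, _, rfl, h2, h5⟩

lemma word_two (T : V → V → Prop) (L : V → W) (w : List W) : ∀ a b : V,
    wordMat T L w a b = two ↔ ∃ s s', s 0 = a ∧ s w.length = b ∧ Pth T L w s ∧
      s' 0 = a ∧ s' w.length = b ∧ Pth T L w s' ∧ ∃ i ≤ w.length, s i ≠ s' i := by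
  induction w with
  | nil =>
    intro a b
    constructor
    · intro h
      by_cases hab : a = b
      · subst hab
        simp only [wordMat, List.map_nil, List.prod_nil, Matrix.one_apply_eq] at h
        exact absurd h.symm two_ne_one'
      · simp only [wordMat, List.map_nil, List.prod_nil, Matrix.one_apply_ne hab] at h
        exact absurd h.symm two_ne_zero'
    · rintro ⟨s, s', h1, -, -, h2, -, -, i, hi, h⟩
      simp only [List.length_nil, Nat.le_zero] at hi
      subst hi
      exact absurd (h1.trans h2.symm) h
  | cons c w ih =>
    intro a b
    rw [wordMat_cons, Matrix.mul_apply, sum_two]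
    constructor
    · rintro (⟨d, -, h⟩ | ⟨d, -, d', -, hd, h, h'⟩)
      · have hn : letterMat T L c a d * wordMat T L w d b ≠ 0 := by
          rw [h]; exact two_ne_zero'
        rw [mul_ne, letter_ne] at hn
        have h1 : letterMat T L c a d = 1 := by unfold letterMat; rw [if_pos hn.1]
        rw [h1, one_mul, ih] at h
        obtain ⟨s, s', h1, h2, h3, h4, h5, h6, i, hi, h7⟩ := h
        exact ⟨consSeq a s, consSeq a s', rfl, h2, ⟨hn.1.1, by show T a (s 0); rw [h1]; exact hn.1.2, h3⟩,
          rfl, h5, ⟨hn.1.1, by show T a (s' 0); rw [h4]; exact hn.1.2, h6⟩, i + 1, by simpa using hi, h7⟩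
      · rw [mul_ne, letter_ne, word_ne] at h h'
        obtain ⟨⟨h1, h2⟩, s, h3, h4, h5⟩ := h
        obtain ⟨⟨h1', h2'⟩, s', h3', h4', h5'⟩ := h'
        exact ⟨consSeq a s, consSeq a s', rfl, h4, ⟨h1, by show T a (s 0); rw [h3]; exact h2, h5⟩,
          rfl, h4', ⟨h1', by show T a (s' 0); rw [h3']; exact h2', h5'⟩, 1, by simp, by
            show s 0 ≠ s' 0
            rw [h3, h3']; exact hd⟩
    · rintro ⟨s, s', h1, h2, ⟨h3, h4, h5⟩, h1', h2', ⟨h3', h4', h5'⟩, i, hi, h7⟩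
      subst h1
      by_cases hs : s 1 = s' 1
      · left
        refine ⟨s 1, Finset.mem_univ _, ?_⟩
        apply (congrArg _ _).trans (mul_two_right _ (letter_ne.2 ⟨h3, h4⟩))
        rw [ih]
        refine ⟨_, _, rfl, h2, h5, hs.symm, h2', h5', i - 1, ?_, ?_⟩
        · simp only [List.length_cons] at hi; omega
        · have : i ≠ 0 := by rintro rfl; exact h7 h1'.symm
          show s (i - 1 + 1) ≠ s' (i - 1 + 1)
          rwa [Nat.sub_add_cancel (by omega)]
      · right
        refine ⟨s 1, Finset.mem_univ _, s' 1, Finset.mem_univ _, hs, ?_, ?_⟩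
        · rw [mul_ne, letter_ne, word_ne]
          exact ⟨⟨h3, h4⟩, _, rfl, h2, h5⟩
        · rw [mul_ne, letter_ne, word_ne]
          exact ⟨⟨h1' ▸ h3', h1' ▸ h4'⟩, _, rfl, h2', h5'⟩

theorem exists_diamond_word [Nonempty V] (T : V → V → Prop) (L : V → W)
    (irr : ∀ a b, ∃ w, wordMat T L w a b ≠ 0) (dia : ∃ a b w, wordMat T L w a b = two) :
    ∃ w, wordMat T L w ≠ 0 ∧ ∀ a b, wordMat T L w a b ≠ 1 := by
  let S : Submonoid (Matrix V V S3) :=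
    { carrier := Set.range (wordMat T L)
      mul_mem' := by
        rintro _ _ ⟨w, rfl⟩ ⟨w', rfl⟩
        exact ⟨w ++ w', wordMat_append T L w w'⟩
      one_mem' := ⟨[], rfl⟩ }
  obtain ⟨_, ⟨w, rfl⟩, h1, h2⟩ := exists_no_one S
    (fun a b => by obtain ⟨w, h⟩ := irr a b; exact ⟨_, ⟨w, rfl⟩, h⟩)
    (by obtain ⟨a, b, w, h⟩ := dia; exact ⟨a, b, _, ⟨w, rfl⟩, h⟩)
  exact ⟨w, h1, h2⟩

/-- The word of length `n` read from `y` at position `p`. -/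
def wd (y : ℤ → W) : ℤ → ℕ → List W
  | _, 0 => []
  | p, n + 1 => y p :: wd y (p + 1) n

lemma wd_length (y : ℤ → W) (n : ℕ) : ∀ p, (wd y p n).length = n := by
  induction n with
  | zero => intro p; rfl
  | succ n ih => intro p; simp [wd, ih]

lemma wd_congr {y y' : ℤ → W} (n : ℕ) : ∀ p q : ℤ, (∀ i : ℕ, i < n → y (p + i) = y' (q + i)) →
    wd y p n = wd y' q n := by
  induction n with
  | zero => intros; rfl
  | succ n ih =>
    intro p q h
    simp only [wd]
    congr 1
    · simpa using h 0 (by omega)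
    · apply ih
      intro i hi
      have := h (i + 1) (by omega)
      push_cast at this
      rwa [add_assoc, add_assoc, add_comm 1]

lemma pth_wd (T : V → V → Prop) (L : V → W) (y : ℤ → W) (n : ℕ) : ∀ (p : ℤ) (s : ℕ → V),
    Pth T L (wd y p n) s ↔ ∀ i : ℕ, i < n → L (s i) = y (p + i) ∧ T (s i) (s (i + 1)) := by
  induction n with
  | zero => intro p s; simp [wd, Pth]
  | succ n ih =>
    intro p s
    simp only [wd, Pth, ih]
    constructor
    · rintro ⟨h1, h2, h3⟩ i hi
      rcases i with _ | i
      · simpa using ⟨h1, h2⟩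
      · have := h3 i (by omega)
        push_cast
        rwa [add_comm (i : ℤ) 1, ← add_assoc]
    · intro h
      refine ⟨by simpa using (h 0 (by omega)).1, (h 0 (by omega)).2, fun i hi => ?_⟩
      have := h (i + 1) (by omega)
      push_cast at this
      rwa [add_comm (i : ℤ) 1, ← add_assoc] at this

lemma exists_wd [Nonempty W] (w : List W) : ∃ y : ℤ → W, w = wd y 0 w.length := by
  obtain ⟨d⟩ := ‹Nonempty W›
  have : ∀ w : List W, ∀ (y : ℤ → W) (p : ℤ), (∀ i : ℕ, ∀ h : i < w.length, y (p + i) = w[i]) →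
      w = wd y p w.length := by
    intro w
    induction w with
    | nil => intros; rfl
    | cons c w ih =>
      intro y p h
      simp only [List.length_cons, wd]
      congr 1
      · have := h 0 (by simp)
        simp only [Nat.cast_zero, add_zero] at this
        rw [this]; rfl
      · apply ih
        intro i hi
        have := h (i + 1) (by simpa using hi)
        push_cast at this
        rw [add_assoc, add_comm 1, this]
        rfl
  exact ⟨fun i => w.getD i.toNat d, this w _ 0 (by intro i h; simp [h])⟩

end Paths
section Shift

open S3

/-- Blocks of length `K` occurring in `X`. -/
def St (X : Set (ℤ → A)) (K : ℕ) : Type u := {w : Fin K → A // OccursIn w X}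

/-- The state of the point `x` at time `i`. -/
def st {X : Set (ℤ → A)} (K : ℕ) {x : ℤ → A} (hx : x ∈ X) (i : ℤ) : St X K :=
  ⟨fun j => x (i + (j.1 : ℤ)), x, hx, i, fun _ => rfl⟩

lemma st_surj {X : Set (ℤ → A)} {K : ℕ} (s : St X K) :
    ∃ x, ∃ hx : x ∈ X, ∃ i, s = st K hx i := by
  obtain ⟨w, x, hx, i, h⟩ := s
  exact ⟨x, hx, i, Subtype.ext (funext fun j => (h j).symm)⟩

def Tr {X : Set (ℤ → A)} {K : ℕ} (s s' : St X K) : Prop :=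
  ∀ (j : ℕ) (h : j + 1 < K), s.1 ⟨j + 1, h⟩ = s'.1 ⟨j, by omega⟩

lemma tr_st {X : Set (ℤ → A)} {K : ℕ} {x : ℤ → A} (hx : x ∈ X) (i i' : ℤ) (hi : i' = i + 1) :
    Tr (st K hx i) (st K hx i') := by
  intro j h
  simp only [st]
  congr 1
  push_cast
  omega

def Lb {X : Set (ℤ → A)} {K r : ℕ} (hr : 2 * r + 1 ≤ K) (Φ : (Fin (2 * r + 1) → A) → B)
    (s : St X K) : B := Φ fun j => s.1 (Fin.castLE hr j)

lemma lb_st {X : Set (ℤ → A)} {K r : ℕ} (hr : 2 * r + 1 ≤ K) {Φ : (Fin (2 * r + 1) → A) → B}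
    {π : (ℤ → A) → ℤ → B} (hΦ : ∀ x i, π x i = Φ fun j => x (i - (r : ℤ) + (j.1 : ℤ)))
    {x : ℤ → A} (hx : x ∈ X) (i : ℤ) : Lb hr Φ (st K hx i) = π x (i + r) := by
  rw [hΦ]
  simp [Lb, st]

lemma splice {X : Set (ℤ → A)} {k K r : ℕ} {P : (Fin k → A) → Prop}
    (hX : X = {x | ∀ i : ℤ, P fun j => x (i + (j.1 : ℤ))}) (hk : k ≤ K)
    (hr : 2 * r + 1 ≤ K) {Φ : (Fin (2 * r + 1) → A) → B}
    {π : (ℤ → A) → ℤ → B} (hΦ : ∀ x i, π x i = Φ fun j => x (i - (r : ℤ) + (j.1 : ℤ)))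
    (S : ℤ → St X K) (hS : ∀ i, Tr (S i) (S (i + 1))) :
    ∃ x, ∃ hx : x ∈ X, ∀ i, S i = st K hx i := by
  let x : ℤ → A := fun i => (S i).1 ⟨0, by omega⟩
  have key : ∀ (j : ℕ) (h : j < K) (i : ℤ), (S i).1 ⟨j, h⟩ = x (i + j) := by
    intro j
    induction j with
    | zero => intro h i; simp [x]
    | succ j ih =>
      intro h i
      rw [hS i j h, ih]
      congr 1
      push_cast
      ring
  have hx : x ∈ X := by
    rw [hX]
    intro i
    obtain ⟨x0, hx0, i0, h0⟩ := (S i).2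
    rw [hX] at hx0
    have := hx0 i0
    convert this using 1
    funext j
    have h1 := h0 (Fin.castLE hk j)
    have h2 := key j.1 (by omega) i
    simp only [Fin.val_castLE] at h1
    rw [h1, ← h2]
    rfl
  exact ⟨x, hx, fun i => Subtype.ext (funext fun j => key j.1 j.2 i)⟩

lemma local_glue {X : Set (ℤ → A)} {k K r : ℕ} {P : (Fin k → A) → Prop}
    (hX : X = {x | ∀ i : ℤ, P fun j => x (i + (j.1 : ℤ))}) (hk : k ≤ K)
    (hr : 2 * r + 1 ≤ K) {Φ : (Fin (2 * r + 1) → A) → B}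
    {π : (ℤ → A) → ℤ → B} (hΦ : ∀ x i, π x i = Φ fun j => x (i - (r : ℤ) + (j.1 : ℤ)))
    (y : ℤ → B) (z : ℤ → A)
    (h : ∀ i : ℤ, ∃ t ∈ X, π t = y ∧ ∀ m, i ≤ m → m < i + K → z m = t m) :
    z ∈ X ∧ π z = y := by
  constructor
  · rw [hX]
    intro i
    obtain ⟨t, ht, -, h⟩ := h i
    rw [hX] at ht
    convert ht i using 1
    funext j
    have := j.2
    exact h _ (by omega) (by omega)
  · funext i
    obtain ⟨t, ht, hty, h⟩ := h (i - r)
    rw [← hty, hΦ, hΦ]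
    congr 1
    funext j
    have := j.2
    exact h _ (by omega) (by omega)

/-- Existence of diamonds far to the right in any preimage of a right transitive point. -/
theorem exists_right_diamond [Fintype A]
    {X : Set (ℤ → A)} {Y : Set (ℤ → B)} {k K r : ℕ} {P : (Fin k → A) → Prop}
    (hX : X = {x | ∀ i : ℤ, P fun j => x (i + (j.1 : ℤ))}) (hk : k ≤ K)
    (hr : 2 * r + 1 ≤ K) {Φ : (Fin (2 * r + 1) → A) → B}
    {π : (ℤ → A) → ℤ → B} (hΦ : ∀ x i, π x i = Φ fun j => x (i - (r : ℤ) + (j.1 : ℤ)))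
    (hXirr : ∀ (p q : ℕ) (u : Fin p → A) (w : Fin q → A),
    OccursIn u X → OccursIn w X →
      ∃ x ∈ X, ∃ i k : ℤ, i + (p : ℤ) ≤ k ∧
        (∀ j : Fin p, x (i + (j.1 : ℤ)) = u j) ∧ ∀ j : Fin q, x (k + (j.1 : ℤ)) = w j)
    (hinf : ∃ y0 ∈ Y, {x | x ∈ X ∧ π x = y0}.Infinite)
    (hπ : ∀ x ∈ X, π x ∈ Y) (hYs : ∀ n : ℤ, ∀ x ∈ Y, shiftMap n x ∈ Y)
    (y : ℤ → B) (hy : RightTransitive Y y) (x : ℤ → A) (hx : x ∈ X) (hxy : π x = y) (N : ℤ) :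
    ∃ x' ∈ X, π x' = y ∧ x' ≠ x ∧ ∃ N', N ≤ N' ∧ ∀ i, (i < N ∨ N' ≤ i) → x' i = x i := by
  classical
  have hfin : Finite (St X K) := Subtype.finite
  have := Fintype.ofFinite (St X K)
  have : Nonempty (St X K) := ⟨st K hx 0⟩
  have : Nonempty B := ⟨y 0⟩
  set T : St X K → St X K → Prop := Tr with hT
  set L : St X K → B := Lb hr Φ with hL
  have hLst : ∀ {x : ℤ → A} (hx : x ∈ X) (i : ℤ), L (st K hx i) = π x (i + r) :=
    fun hx i => lb_st hr hΦ hx i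
  -- irreducibility
  have irr : ∀ a b, ∃ w, wordMat T L w a b ≠ 0 := by
    intro a b
    obtain ⟨x, hx, i, l, hil, h1, h2⟩ := hXirr K K a.1 b.1 a.2 b.2
    refine ⟨wd (fun i => π x (i + r)) i (l - i).toNat, ?_⟩
    rw [word_ne]
    refine ⟨fun j => st K hx (i + j), ?_, ?_, ?_⟩
    · exact Subtype.ext (funext fun j => by simp [st, h1])
    · refine Subtype.ext (funext fun j => ?_)
      rw [wd_length]
      simp only [st]
      rw [← h2 j]
      congr 1
      omega
    · rw [pth_wd]
      intro j hj
      exact ⟨hLst hx _, tr_st hx _ _ (by push_cast; ring)⟩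
  -- a diamond
  have dia : ∃ a b w, wordMat T L w a b = two := by
    obtain ⟨y0, hy0, hinf⟩ := hinf
    obtain ⟨t, ht, htc⟩ := hinf.exists_subset_card_eq
      (Fintype.card ((Fin K → A) × (Fin K → A)) + 1)
    have hd : ∀ x x' : ℤ → A, ∃ i, x ≠ x' → x i ≠ x' i := by
      intro x x'
      by_cases h : x = x'
      · exact ⟨0, fun h' => absurd h h'⟩
      · obtain ⟨i, hi⟩ := Function.ne_iff.1 h
        exact ⟨i, fun _ => hi⟩
    choose d hd using hd
    let n : ℕ := t.sup fun x => t.sup fun x' => (d x x').natAbs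
    have hn : ∀ x ∈ t, ∀ x' ∈ t, (d x x').natAbs ≤ n := by
      intro x hx x' hx'
      exact (Finset.le_sup (f := fun x' => (d x x').natAbs) hx').trans
        (Finset.le_sup (f := fun x => t.sup fun x' => (d x x').natAbs) hx)
    obtain ⟨x1, hx1, x2, hx2, hne, heq⟩ := Finset.exists_ne_map_eq_of_card_lt_of_maps_to
      (s := t) (t := (Finset.univ : Finset ((Fin K → A) × (Fin K → A))))
      (by rw [htc, Finset.card_univ]; omega)
      (f := fun x => (fun j : Fin K => x (-(n : ℤ) + (j.1 : ℤ)), fun j : Fin K => x (n + (j.1 : ℤ))))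
      (fun _ _ => by simp)
    have hX1 := ht hx1
    have hX2 := ht hx2
    have hdn := hn x1 hx1 x2 hx2
    have hdd := hd x1 x2 hne
    set D := d x1 x2
    simp only [Prod.mk.injEq] at heq
    refine ⟨st K hX1.1 (-n), st K hX1.1 n, wd (fun i => y0 (i + r)) (-n) (2 * n), ?_⟩
    rw [word_two]
    simp only [wd_length]
    refine ⟨fun j => st K hX1.1 (-n + j), fun j => st K hX2.1 (-n + j), ?_, ?_, ?_, ?_, ?_, ?_,
      (D + n).toNat, by omega, ?_⟩
    · simp
    · show st K hX1.1 _ = _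
      congr 1
      push_cast; ring
    · rw [pth_wd]
      intro j hj
      refine ⟨?_, tr_st _ _ _ (by push_cast; ring)⟩
      rw [hLst, hX1.2]
    · simp only [Nat.cast_zero, add_zero]
      exact Subtype.ext heq.1.symm
    · have : -(n : ℤ) + ((2 * n : ℕ) : ℤ) = n := by push_cast; ring
      simp only [this]
      exact Subtype.ext heq.2.symm
    · rw [pth_wd]
      intro j hj
      refine ⟨?_, tr_st _ _ _ (by push_cast; ring)⟩
      rw [hLst, hX2.2]
    · intro h
      have h := congrFun (congrArg Subtype.val h) ⟨0, by omega⟩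
      simp only [st] at h
      have e : -(n : ℤ) + ((D + n).toNat : ℤ) + ((0 : ℕ) : ℤ) = D := by omega
      rw [e] at h
      exact hdd h
  obtain ⟨w, hw0, hw1⟩ := exists_diamond_word T L irr dia
  -- `w` occurs in `Y`
  have hz : ∃ z ∈ X, w = wd (fun i => π z (i + r)) 0 w.length := by
    obtain ⟨a, b, hab⟩ := mat_exists hw0
    obtain ⟨y0, hy0⟩ := exists_wd w
    set n := w.length
    rw [hy0, word_ne] at hab
    obtain ⟨s, h1, h2, h3⟩ := hab
    rw [wd_length] at h2
    rw [pth_wd] at h3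
    obtain ⟨x1, hx1, i1, e1⟩ := st_surj a
    obtain ⟨x2, hx2, i2, e2⟩ := st_surj b
    let S : ℤ → St X K := fun i => if i < 0 then st K hx1 (i1 + i) else
      if i < n then s i.toNat else st K hx2 (i2 + (i - n))
    have S1 : ∀ i : ℤ, i ≤ 0 → S i = st K hx1 (i1 + i) := by
      intro i hi
      rcases hi.lt_or_eq with hi | rfl
      · simp only [S, if_pos hi]
      · simp only [S, lt_irrefl, if_false]
        split_ifs with h
        · simp [h1, e1]
        · have : n = 0 := by omega
          rw [this] at h2
          simp [this, ← e2, ← h2, h1, e1]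
    have S2 : ∀ i : ℕ, i ≤ n → S i = s i := by
      intro i hi
      rcases hi.lt_or_eq with hi | rfl
      · simp [S, hi]
      · simp [S, h2, e2]
    have S3' : ∀ i : ℤ, n ≤ i → S i = st K hx2 (i2 + (i - n)) := by
      intro i hi
      simp only [S]
      rw [if_neg (by omega), if_neg (by omega)]
    obtain ⟨z, hz, hzS⟩ := splice hX hk hr hΦ S (by
      intro i
      rcases lt_or_ge i 0 with hi | hi
      · rw [S1 i hi.le, S1 (i + 1) (by omega)]
        exact tr_st _ _ _ (by ring)
      rcases lt_or_ge i n with hi' | hi'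
      · obtain ⟨j, rfl⟩ := Int.eq_ofNat_of_zero_le hi
        have := S2 (j + 1) (by omega)
        push_cast at this
        rw [this, S2 j (by omega)]
        exact (h3 j (by omega)).2
      · rw [S3' i hi', S3' (i + 1) (by omega)]
        exact tr_st _ _ _ (by ring))
    refine ⟨z, hz, ?_⟩
    rw [hy0]
    apply wd_congr
    intro i hi
    rw [← (h3 i hi).1, ← hLst hz, zero_add, ← hzS, S2 i hi.le]
  obtain ⟨z, hz, hwz⟩ := hz
  set n := w.length with hn
  obtain ⟨q, hq, hyq⟩ := hy.2 _ (hYs (-N) _ (hπ z hz)) (N.natAbs + r + n)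
  set p := N + q with hp
  have hwy : w = wd (fun i => y (i + r)) p n := by
    rw [hwz]
    apply wd_congr
    intro i hi
    have := hyq (N + i + r) (by rw [abs_le]; omega)
    simp only [shiftMap] at this
    rw [show p + i + r = N + i + r + q by rw [hp]; ring, this]
    congr 1
    ring
  -- the path of x
  let s : ℕ → St X K := fun j => st K hx (p + j)
  have hs : Pth T L (wd (fun i => y (i + r)) p n) s := by
    rw [pth_wd]
    intro j hj
    refine ⟨?_, tr_st _ _ _ (by push_cast; ring)⟩
    rw [hLst, hxy]
  have hne : wordMat T L w (s 0) (s n) ≠ 0 := by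
    rw [word_ne]
    exact ⟨s, rfl, rfl, by rw [hwy]; exact hs⟩
  have h2 : wordMat T L w (s 0) (s n) = two := by
    rcases cases' (wordMat T L w (s 0) (s n)) with h | h | h
    · exact absurd h hne
    · exact absurd h (hw1 _ _)
    · exact h
  have hτ : ∃ τ : ℕ → St X K, τ 0 = s 0 ∧ τ n = s n ∧ Pth T L w τ ∧ ∃ i ≤ n, τ i ≠ s i := by
    rw [word_two] at h2
    obtain ⟨σ, σ', h1, h2, h3, h1', h2', h3', i, hi, h⟩ := h2
    by_cases hc : σ i = s i
    · exact ⟨σ', h1', h2', h3', i, hi, fun h' => h (hc.trans h'.symm)⟩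
    · exact ⟨σ, h1, h2, h3, i, hi, hc⟩
  obtain ⟨τ, t0, tn, tp, i0, hi0, ht⟩ := hτ
  rw [hwy, pth_wd] at tp
  let S : ℤ → St X K := fun i => if p ≤ i ∧ i ≤ p + n then τ (i - p).toNat else st K hx i
  have Sout : ∀ i, i ≤ p ∨ p + n ≤ i → S i = st K hx i := by
    intro i hi
    simp only [S]
    split_ifs with h
    · rcases hi with hi | hi
      · have : i = p := by omega
        subst this
        simp [t0, s]
      · have : i = p + n := by omega
        subst this
        simp [tn, s]
    · rfl
  have Sin : ∀ i : ℕ, i ≤ n → S (p + i) = τ i := by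
    intro i hi
    simp only [S]
    rw [if_pos (by omega)]
    congr 1
    omega
  have SL : ∀ i, L (S i) = y (i + r) ∧ T (S i) (S (i + 1)) := by
    intro i
    by_cases hi : p ≤ i ∧ i < p + n
    · obtain ⟨j, rfl⟩ : ∃ j : ℕ, i = p + j := ⟨(i - p).toNat, by omega⟩
      have := Sin (j + 1) (by omega)
      push_cast at this
      rw [← add_assoc] at this
      rw [this, Sin j (by omega)]
      exact tp j (by omega)
    · rw [Sout i (by omega), Sout (i + 1) (by omega), hLst, hxy]
      exact ⟨rfl, tr_st _ _ _ rfl⟩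
  obtain ⟨x', hx', hS⟩ := splice hX hk hr hΦ S (fun i => (SL i).2)
  refine ⟨x', hx', ?_, ?_, p + n + 1, by omega, ?_⟩
  · funext i
    have h1 := (SL (i - r)).1
    rw [hS, hLst] at h1
    simpa using h1
  · rintro rfl
    apply ht
    rw [← Sin i0 hi0, hS]
  · intro i hi
    have h1 := Sout i (by omega)
    rw [hS] at h1
    have h1 := congrFun (congrArg Subtype.val h1) ⟨0, by omega⟩
    simpa [st] using h1

end Shift

theorem transClass_uncountable_of_infinite_to_one [Fintype A] [TopologicalSpace A] [DiscreteTopology A]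
    [Fintype B] [TopologicalSpace B] [DiscreteTopology B]
    (X : Set (ℤ → A)) (Y : Set (ℤ → B)) (π : (ℤ → A) → ℤ → B)
    (hT : FactorTriple X Y π) (hXirr : IrreducibleSubshift X)
    (hinf : ∃ y0 ∈ Y, {x | x ∈ X ∧ π x = y0}.Infinite)
    (y : ℤ → B) (hy : RightTransitive Y y) :
    ∀ C ∈ transClassesOver X π y, ¬ C.Countable := by
  classical
  obtain ⟨⟨⟨-, -⟩, k, P, hX⟩, ⟨-, hYs⟩, ⟨r, Φ, hΦ⟩, hπ, -⟩ := hT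
  rintro C ⟨x, hx, hxy, rfl⟩
  obtain ⟨K, hk, hr⟩ : ∃ K : ℕ, k ≤ K ∧ 2 * r + 1 ≤ K := ⟨max k (2 * r + 1), by simp, by simp⟩
  have D := exists_right_diamond hX hk hr hΦ hXirr hinf hπ hYs y hy x hx hxy
  choose g hgX hgy hgne E hE hgE using D
  let a : ℕ → ℤ := fun n => Nat.rec (motive := fun _ => ℤ) 0 (fun _ b => E b + K) n
  have ha : ∀ n, a (n + 1) = E (a n) + K := fun n => rfl
  have hlt : ∀ l m, l < m → E (a l) + K ≤ a m := by
    intro l m hlm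
    induction m with
    | zero => omega
    | succ m ih =>
      rw [ha]
      rcases Nat.lt_succ_iff_lt_or_eq.1 hlm with h | rfl
      · have := ih h
        have := hE (a m)
        omega
      · exact le_rfl
  have hge : ∀ n : ℕ, (n : ℤ) ≤ a n := by
    intro n
    induction n with
    | zero => exact le_rfl
    | succ n ih =>
      rw [ha]
      have := hE (a n)
      push_cast
      omega
  let I : ℕ → ℤ → Prop := fun l m => a l ≤ m ∧ m < E (a l)
  have hIu : ∀ l l' m, I l m → I l' m → l = l' := by
    intro l l' m h h'
    simp only [I] at h h'
    rcases lt_trichotomy l l' with hl | hl | hl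
    · have := hlt _ _ hl; omega
    · exact hl
    · have := hlt _ _ hl; omega
  let Z : Set ℕ → ℤ → A := fun (f : Set ℕ) (m : ℤ) =>
    @dite A (∃ l : ℕ, l ∈ f ∧ I l m) (Classical.propDecidable _) (fun h => g (a h.choose) m)
      (fun _ => x m)
  have Z1 : ∀ f l m, l ∈ f → I l m → Z f m = g (a l) m := by
    intro f l m hl hI
    have h : ∃ l, l ∈ f ∧ I l m := ⟨l, hl, hI⟩
    simp only [Z, dif_pos h]
    rw [hIu _ _ m h.choose_spec.2 hI]
  have Z2 : ∀ f m, (∀ l, l ∈ f → ¬ I l m) → Z f m = x m := by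
    intro f m h
    simp only [Z]
    rw [dif_neg]
    rintro ⟨l, hl, hI⟩
    exact h l hl hI
  have Zag : ∀ f f' m, (∀ l, I l m → (l ∈ f ↔ l ∈ f')) → Z f m = Z f' m := by
    intro f f' m h
    by_cases hf : ∃ l, l ∈ f ∧ I l m
    · obtain ⟨l, hl, hI⟩ := hf
      rw [Z1 f l m hl hI, Z1 f' l m ((h l hI).1 hl) hI]
    · push Not at hf
      rw [Z2 f m hf, Z2 f' m (fun l hl hI => hf l ((h l hI).2 hl) hI)]
  have Zx : ∀ f m, (∀ l, I l m → l ∉ f) → Z f m = x m := fun f m h =>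
    Z2 f m (fun l hl hI => h l hI hl)
  have ZX : ∀ f, Z f ∈ X ∧ π (Z f) = y := by
    intro f
    apply local_glue hX hk hr hΦ
    intro i
    by_cases hf : ∃ l, l ∈ f ∧ ∃ m, i ≤ m ∧ m < i + K ∧ I l m
    · obtain ⟨l, hl, m0, h1, h2, hI0⟩ := hf
      refine ⟨g (a l), hgX _, hgy _, fun m hm hm' => ?_⟩
      by_cases hI : I l m
      · exact Z1 f l m hl hI
      · rw [hgE (a l) m (by simp only [I] at hI; omega)]
        apply Z2
        intro l' hl' hI'
        have hne : l ≠ l' := by rintro rfl; exact hI hI'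
        simp only [I] at hI0 hI'
        rcases lt_or_gt_of_ne hne with hl | hl
        · have := hlt _ _ hl; omega
        · have := hlt _ _ hl; omega
    · push Not at hf
      exact ⟨x, hx, hxy, fun m hm hm' => Z2 f m (fun l hl => hf l hl m hm hm')⟩
  have hmem : ∀ f, Z f ∈ transClass X π x := by
    intro f
    refine ⟨(ZX f).1, (ZX f).2.trans hxy.symm, fun n => ?_, fun n => ?_⟩
    · have hb := hge (n.toNat + 1)
      push_cast at hb
      refine ⟨Z (f ∩ {l | n.toNat + 1 ≤ l}), (ZX _).1, (ZX _).2.trans hxy.symm, ?_,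
        a (n.toNat + 1), by omega, ?_⟩
      · intro m hm
        apply Zx
        rintro l hI ⟨-, hl⟩
        have := hge l
        simp only [I, Set.mem_setOf_eq] at hI hl
        omega
      · intro m hm
        apply Zag
        intro l hI
        constructor
        · exact fun h => h.1
        · intro h
          refine ⟨h, ?_⟩
          by_contra hl
          simp only [Set.mem_setOf_eq, not_le] at hl
          have := hlt _ _ hl
          simp only [I] at hI
          omega
    · have hb := hge (n.toNat + 1)
      push_cast at hb
      refine ⟨Z (f ∩ {l | l < n.toNat + 1}), (ZX _).1, (ZX _).2.trans (ZX _).2.symm, ?_,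
        a (n.toNat + 1), by omega, ?_⟩
      · intro m hm
        apply Zag
        intro l hI
        constructor
        · exact fun h => h.1
        · intro h
          refine ⟨h, ?_⟩
          by_contra hl
          simp only [Set.mem_setOf_eq, not_lt] at hl
          have := hge l
          simp only [I] at hI
          omega
      · intro m hm
        apply Zx
        rintro l hI ⟨-, hl⟩
        have := hlt _ _ (show l < n.toNat + 1 from hl)
        simp only [I] at hI
        omega
  have hsep : ∀ f f' l, l ∈ f → l ∉ f' → Z f ≠ Z f' := by
    intro f f' l hl hl' heq
    obtain ⟨m, hm⟩ := Function.ne_iff.1 (hgne (a l))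
    have hI : I l m := by
      by_contra hI
      exact hm (hgE (a l) m (by simp only [I] at hI; omega))
    have h1 := congrFun heq m
    rw [Z1 f l m hl hI, Zx f' m (fun l' hI' => by rwa [hIu _ _ _ hI' hI])] at h1
    exact hm h1
  have hinj : Function.Injective Z := by
    intro f f' heq
    ext l
    constructor
    · intro h; by_contra h'; exact hsep f f' l h h' heq
    · intro h; by_contra h'; exact hsep f' f l h h' heq.symm
  intro hC
  haveI : Countable (transClass X π x) := hC
  obtain ⟨φ, hφ⟩ := exists_injective_nat (transClass X π x)
  refine Function.cantor_injective (fun f : Set ℕ => φ ⟨Z f, hmem f⟩) ?_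
  intro f f' h
  exact hinj (congrArg Subtype.val (hφ h))
end

section
/- Let (X, Y, π) be an irreducible factor triple with X one-step and π one-block, and let y ∈ Y be right transitive. Then any two points lying in two distinct transition classes over y are mutually separated, i.e., x_i ≠ x̄_i for every integer i. -/
open Set

universe u v uc

variable {A : Type u} {B : Type v}

section Helpers

open Relation

/-- `rp T n` is the `(n+1)`-st power of the relation `T`. -/
def rp (T : A → A → Prop) : ℕ → A → A → Prop
  | 0 => T
  | n + 1 => Comp (rp T n) T

theorem rp_add (T : A → A → Prop) (m n : ℕ) :
    Comp (rp T m) (rp T n) = rp T (m + n + 1) := by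
  induction n with
  | zero => rfl
  | succ n ih =>
    change Comp (rp T m) (Comp (rp T n) T) = Comp (rp T (m + n + 1)) T
    rw [← ih, comp_assoc]

theorem exists_idem_rp [Finite A] (T : A → A → Prop) :
    ∃ N, Comp (rp T N) (rp T N) = rp T N := by
  obtain ⟨a, b, hab, h⟩ := Finite.exists_ne_map_eq_of_infinite (rp T)
  wlog hlt : a < b generalizing a b
  · exact this b a hab.symm h.symm (by omega)
  obtain ⟨d, rfl⟩ : ∃ d, b = a + (d + 1) := ⟨b - a - 1, by omega⟩
  have h1 : ∀ k, rp T (a + k) = rp T (a + k + (d + 1)) := by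
    intro k
    induction k with
    | zero => exact h
    | succ k ih =>
      change Comp (rp T (a + k)) T = _
      rw [ih]
      have : a + (k + 1) + (d + 1) = (a + k + (d + 1)) + 1 := by ring
      rw [this]
      rfl
  have h2 : ∀ j k, rp T (a + k) = rp T (a + k + j * (d + 1)) := by
    intro j
    induction j with
    | zero => intro k; simp
    | succ j ih =>
      intro k
      rw [ih k, add_assoc, h1]
      congr 1
      ring
  refine ⟨a + (a * d + d), ?_⟩
  rw [rp_add, h2 (a + 1) (a * d + d)]
  congr 1
  ring

theorem rp_mem {H : (A → A → Prop) → Prop}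
    (hcomp : ∀ R S, H R → H S → H (Comp R S)) {T : A → A → Prop} (hT : H T) (n : ℕ) :
    H (rp T n) := by
  induction n with
  | zero => exact hT
  | succ n ih => exact hcomp _ _ ih hT

theorem rp_left {T : A → A → Prop} {j k : A} (hj : T j j) (hk : T j k) (n : ℕ) :
    rp T n j k := by
  have h : ∀ n, rp T n j j := by
    intro n
    induction n with
    | zero => exact hj
    | succ n ih => exact ⟨j, ih, hj⟩
  cases n with
  | zero => exact hk
  | succ n => exact ⟨j, h n, hk⟩

theorem idem_refl [Finite A] {M : Finset A} {E : A → A → Prop}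
    (hidem : Comp E E = E) (hsub : ∀ a b, E a b → a ∈ M ∧ b ∈ M)
    (hmin : ∀ k ∈ M, ¬ (∀ p q, E p q → ∃ r ∈ M, r ≠ k ∧ E p r ∧ E r q))
    {i : A} (hi : i ∈ M) : E i i := by
  by_contra hii
  refine hmin i hi fun p q hpq => ?_
  have tr : ∀ {a b c}, E a b → E b c → E a c := by
    intro a b c h1 h2
    rw [← hidem]
    exact ⟨b, h1, h2⟩
  have dens : ∀ r, ∃ s, E r q → E r s ∧ E s q := by
    intro r
    by_cases h : E r q
    · rw [← hidem] at h
      obtain ⟨s, hs⟩ := h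
      exact ⟨s, fun _ => hs⟩
    · exact ⟨r, fun h' => absurd h' h⟩
  choose f hf using dens
  have hq : ∀ n, E (f^[n] p) q := by
    intro n
    induction n with
    | zero => exact hpq
    | succ n ih =>
      rw [Function.iterate_succ_apply']
      exact (hf _ ih).2
  have hstep : ∀ m d, E (f^[m] p) (f^[m + d + 1] p) := by
    intro m d
    induction d with
    | zero =>
      rw [add_zero, Function.iterate_succ_apply']
      exact (hf _ (hq m)).1
    | succ d ih =>
      refine tr ih ?_
      have : m + (d + 1) + 1 = (m + d + 1) + 1 := by ring
      rw [this, Function.iterate_succ_apply' f (m + d + 1)]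
      exact (hf _ (hq _)).1
  obtain ⟨a, b, hab, h⟩ := Finite.exists_ne_map_eq_of_infinite (fun n => f^[n] p)
  wlog hlt : a < b generalizing a b
  · exact this b a hab.symm h.symm (by omega)
  obtain ⟨d, rfl⟩ : ∃ d, b = a + d + 1 := ⟨b - a - 1, by omega⟩
  have hrr := hstep a d
  rw [h] at hrr
  have hpr := hstep 0 (a + d)
  rw [zero_add] at hpr
  refine ⟨_, (hsub _ _ hrr).1, ?_, hpr, hq _⟩
  rintro rfl
  exact hii hrr

theorem functional_of_min [Finite A] (M : Finset A) (H : (A → A → Prop) → Prop)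
    (hcomp : ∀ R S, H R → H S → H (Comp R S))
    (hsub : ∀ R, H R → ∀ a b, R a b → a ∈ M ∧ b ∈ M)
    (hirr : ∀ m ∈ M, ∀ m' ∈ M, ∃ R, H R ∧ R m m')
    (hmin : ∀ E, H E → Comp E E = E → (∃ a b, E a b) →
      ∀ k ∈ M, ¬ (∀ p q, E p q → ∃ r ∈ M, r ≠ k ∧ E p r ∧ E r q))
    (T : A → A → Prop) (hT : H T) (i j k : A) (hij : T i j) (hik : T i k) : j = k := by
  by_contra hjk
  have hi := (hsub T hT _ _ hij).1
  have hj := (hsub T hT _ _ hij).2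
  have hk := (hsub T hT _ _ hik).2
  -- idempotent `E` with `E j j`, `E j k`
  have key : ∀ S, H S → ∀ j k, S j j → S j k →
      ∃ E, H E ∧ Comp E E = E ∧ E j k ∧ ∀ m ∈ M, E m m := by
    intro S hS j k h1 h2
    obtain ⟨N, hN⟩ := exists_idem_rp S
    have hE := rp_mem hcomp hS N
    have h3 := rp_left h1 h2 N
    exact ⟨rp S N, hE, hN, h3, fun m hm =>
      idem_refl hN (hsub _ hE) (hmin _ hE hN ⟨_, _, h3⟩) hm⟩
  obtain ⟨T', hT', h'⟩ := hirr j hj i hi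
  obtain ⟨E, hE, -, hEjk, hEr⟩ :=
    key _ (hcomp _ _ hT' hT) j k ⟨i, h', hij⟩ ⟨i, h', hik⟩
  obtain ⟨T2, hT2, h2⟩ := hirr k hk j hj
  obtain ⟨F, hF, -, hFkj, hFr⟩ :=
    key _ (hcomp _ _ hT2 hE) k j ⟨j, h2, hEjk⟩ ⟨j, h2, hEr j hj⟩
  have hG := hcomp _ _ hE hF
  have hGjk : Comp E F j k := ⟨k, hEjk, hFr k hk⟩
  have hGkj : Comp E F k j := ⟨k, hEr k hk, hFkj⟩
  have hGj : Comp E F j j := ⟨j, hEr j hj, hFr j hj⟩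
  have hGk : Comp E F k k := ⟨k, hEr k hk, hFr k hk⟩
  obtain ⟨N, hN⟩ := exists_idem_rp (Comp E F)
  have hK := rp_mem hcomp hG N
  have hKjk := rp_left hGj hGjk N
  have hKkj := rp_left hGk hGkj N
  have tr : ∀ {a b c}, rp (Comp E F) N a b → rp (Comp E F) N b c → rp (Comp E F) N a c := by
    intro a b c h1 h2
    rw [← hN]
    exact ⟨b, h1, h2⟩
  refine hmin _ hK hN ⟨_, _, hKjk⟩ k hk fun p q hpq => ?_
  rw [← hN] at hpq
  obtain ⟨r, hpr, hrq⟩ := hpq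
  by_cases hr : r = k
  · subst hr
    exact ⟨j, hj, hjk, tr hpr hKkj, tr hKjk hrq⟩
  · exact ⟨r, (hsub _ hK _ _ hrq).1, hr, hpr, hrq⟩

/-- `a` occurs in `X` -/
def Occ (X : Set (ℤ → A)) (a : A) : Prop := ∃ x ∈ X, ∃ i : ℤ, x i = a

/-- `a b` occurs in `X` -/
def Ed (X : Set (ℤ → A)) (a b : A) : Prop := ∃ x ∈ X, ∃ i : ℤ, x i = a ∧ x (i + 1) = b

/-- path in `X` from `a` to `b` whose image (excluding the first symbol) is the word -/
def WP (X : Set (ℤ → A)) (Φ : A → B) : List B → A → A → Prop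
  | [], a, b => a = b ∧ Occ X a
  | w :: ws, a, b => ∃ c, Ed X a c ∧ Φ c = w ∧ WP X Φ ws c b

theorem WP.occ_left {X : Set (ℤ → A)} {Φ : A → B} {w : List B} {a b : A}
    (h : WP X Φ w a b) : Occ X a := by
  cases w with
  | nil => exact h.2
  | cons w ws =>
    obtain ⟨c, ⟨x, hx, i, h1, h2⟩, -⟩ := h
    exact ⟨x, hx, i, h1⟩

theorem WP.occ_right {X : Set (ℤ → A)} {Φ : A → B} {w : List B} {a b : A}
    (h : WP X Φ w a b) : Occ X b := by
  induction w generalizing a with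
  | nil => exact h.1 ▸ h.2
  | cons w ws ih =>
    obtain ⟨c, -, -, h⟩ := h
    exact ih h

theorem WP_append {X : Set (ℤ → A)} {Φ : A → B} (u v : List B) (a b : A) :
    WP X Φ (u ++ v) a b ↔ ∃ c, WP X Φ u a c ∧ WP X Φ v c b := by
  induction u generalizing a with
  | nil =>
    constructor
    · intro h
      exact ⟨a, ⟨rfl, h.occ_left⟩, h⟩
    · rintro ⟨c, ⟨rfl, -⟩, h⟩
      exact h
  | cons w ws ih =>
    constructor
    · rintro ⟨c, h1, h2, h3⟩
      obtain ⟨d, h4, h5⟩ := (ih c).1 h3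
      exact ⟨d, ⟨c, h1, h2, h4⟩, h5⟩
    · rintro ⟨d, ⟨c, h1, h2, h4⟩, h5⟩
      exact ⟨c, h1, h2, (ih c).2 ⟨d, h4, h5⟩⟩

/-- the word `y (s+1) ... y (s+n)` -/
def yw (y : ℤ → B) : ℤ → ℕ → List B
  | _, 0 => []
  | s, n + 1 => y (s + 1) :: yw y (s + 1) n

theorem yw_congr (y y' : ℤ → B) (s t : ℤ) (n : ℕ)
    (h : ∀ j : ℤ, 1 ≤ j → j ≤ n → y (s + j) = y' (t + j)) : yw y s n = yw y' t n := by
  induction n generalizing s t with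
  | zero => rfl
  | succ n ih =>
    simp only [yw]
    rw [h 1 le_rfl (by push_cast; omega), ih]
    intro j h1 h2
    have := h (1 + j) (by omega) (by push_cast; omega)
    rwa [← add_assoc, ← add_assoc] at this

theorem WP_of_point {X : Set (ℤ → A)} {Φ : A → B} {x : ℤ → A} (hx : x ∈ X) (s : ℤ) (n : ℕ) :
    WP X Φ (yw (fun i => Φ (x i)) s n) (x s) (x (s + n)) := by
  induction n generalizing s with
  | zero => exact ⟨by simp, x, hx, s, rfl⟩
  | succ n ih =>
    refine ⟨x (s + 1), ⟨x, hx, s, rfl, rfl⟩, rfl, ?_⟩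
    have := ih (s + 1)
    rwa [show s + 1 + (n : ℤ) = s + ((n + 1 : ℕ) : ℤ) by push_cast; ring] at this

theorem glue [TopologicalSpace A] {X : Set (ℤ → A)} (hX1 : IsOneStep X) {x x' : ℤ → A}
    (hx : x ∈ X) (hx' : x' ∈ X) (s t : ℤ) (h : x s = x' t) :
    ∃ z ∈ X, (∀ m ≤ s, z m = x m) ∧ ∀ m, s ≤ m → z m = x' (m - s + t) := by
  obtain ⟨-, T, rfl⟩ := hX1
  refine ⟨fun m => if m ≤ s then x m else x' (m - s + t), ?_, ?_, ?_⟩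
  · intro i
    dsimp only
    rcases lt_trichotomy i s with h1 | h1 | h1
    · rw [if_pos h1.le, if_pos (by omega)]
      exact hx i
    · subst h1
      rw [if_pos le_rfl, if_neg (by omega), h]
      have := hx' t
      rwa [show i + 1 - i + t = t + 1 by ring]
    · rw [if_neg (by omega), if_neg (by omega)]
      have := hx' (i - s + t)
      rwa [show i + 1 - s + t = i - s + t + 1 by ring]
  · intro m hm
    simp [hm]
  · intro m hm
    rcases hm.eq_or_lt with rfl | hm
    · simp [h]
    · simp [not_le.2 hm]

theorem point_of_WP [TopologicalSpace A] {X : Set (ℤ → A)} (hX1 : IsOneStep X) {Φ : A → B}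
    (w : List B) (x x' : ℤ → A) (hx : x ∈ X) (hx' : x' ∈ X) (s t : ℤ)
    (h : WP X Φ w (x s) (x' t)) :
    ∃ z ∈ X, (∀ m ≤ s, z m = x m) ∧ yw (fun i => Φ (z i)) s w.length = w ∧
      ∀ m, s + w.length ≤ m → z m = x' (m - (s + w.length) + t) := by
  induction w generalizing x s with
  | nil =>
    obtain ⟨z, hz, h1, h2⟩ := glue hX1 hx hx' s t h.1
    exact ⟨z, hz, h1, rfl, by simpa using h2⟩
  | cons b ws ih =>
    obtain ⟨c, ⟨e, he, i, hi1, hi2⟩, hc, hw⟩ := h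
    obtain ⟨x1, hx1, h1, h2⟩ := glue hX1 hx he s i hi1.symm
    have h3 : x1 (s + 1) = c := by
      rw [h2 _ (by omega), ← hi2]
      congr 1
      ring
    rw [← h3] at hw
    obtain ⟨z, hz, k1, k2, k3⟩ := ih x1 hx1 (s + 1) hw
    refine ⟨z, hz, ?_, ?_, ?_⟩
    · intro m hm
      rw [k1 m (by omega), h1 m hm]
    · simp only [List.length_cons, yw]
      rw [k2, k1 _ le_rfl, h3, hc]
    · intro m hm
      simp only [List.length_cons] at hm ⊢
      push_cast at hm ⊢
      rw [k3 m (by omega)]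
      congr 1
      ring

theorem yw_inj (y y' : ℤ → B) (s : ℤ) (n : ℕ) (h : yw y s n = yw y' s n) :
    ∀ m, s < m → m ≤ s + n → y m = y' m := by
  induction n generalizing s with
  | zero => intro m h1 h2; simp at h2; omega
  | succ n ih =>
    simp only [yw, List.cons.injEq] at h
    intro m h1 h2
    by_cases hm : m = s + 1
    · rw [hm, h.1]
    · exact ih (s + 1) h.2 m (by omega) (by push_cast at h2; omega)

theorem irr_word [TopologicalSpace A] {X : Set (ℤ → A)} (hirr : IrreducibleSubshift X)
    (Φ : A → B) {a b : A} (ha : Occ X a) (hb : Occ X b) : ∃ w, WP X Φ w a b := by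
  obtain ⟨x, hx, i, hi⟩ := ha
  obtain ⟨x', hx', i', hi'⟩ := hb
  obtain ⟨z, hz, s, t, hst, h1, h2⟩ := hirr 1 1 (fun _ => a) (fun _ => b)
    ⟨x, hx, i, fun j => by simp [hi]⟩ ⟨x', hx', i', fun j => by simp [hi']⟩
  have h1 := h1 0
  have h2 := h2 0
  simp only [Fin.val_zero, Nat.cast_zero, add_zero] at h1 h2
  obtain ⟨n, rfl⟩ : ∃ n : ℕ, t = s + n := ⟨(t - s).toNat, by push_cast at hst; omega⟩
  rw [← h1, ← h2]
  exact ⟨_, WP_of_point hz s n⟩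

/-- A factorization of the word `u ++ v` through the set `M`. -/
def Good (X : Set (ℤ → A)) (Φ : A → B) (u v : List B) (M : Finset A) : Prop :=
  (∃ a b, WP X Φ (u ++ v) a b) ∧
    ∀ a b, WP X Φ (u ++ v) a b → ∃ m ∈ M, WP X Φ u a m ∧ WP X Φ v m b

theorem exists_min_good [Fintype A] {X : Set (ℤ → A)} (Φ : A → B) (hne : X.Nonempty) :
    ∃ u v M, Good X Φ u v M ∧ ∀ u' v' M', Good X Φ u' v' M' → M.card ≤ M'.card := by
  classical
  have hex : ∃ n, ∃ u v M, Good X Φ u v M ∧ M.card = n := by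
    obtain ⟨x, hx⟩ := hne
    refine ⟨_, [], [], Finset.univ, ⟨⟨x 0, x 0, rfl, x, hx, 0, rfl⟩, ?_⟩, rfl⟩
    intro a b h
    exact ⟨a, Finset.mem_univ _, ⟨rfl, h.2⟩, h⟩
  obtain ⟨u, v, M, h1, h2⟩ := Nat.find_spec hex
  refine ⟨u, v, M, h1, fun u' v' M' h' => ?_⟩
  rw [h2]
  exact Nat.find_min' hex ⟨u', v', M', h', rfl⟩

theorem good_functional [Fintype A] [TopologicalSpace A] {X : Set (ℤ → A)}
    (hirr : IrreducibleSubshift X) (Φ : A → B) {u v : List B} {M : Finset A}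
    (hg : Good X Φ u v M) (hmin : ∀ u' v' M', Good X Φ u' v' M' → M.card ≤ M'.card) :
    (∀ m ∈ M, (∃ a, WP X Φ u a m) ∧ ∃ b, WP X Φ v m b) ∧
    ∀ z i j k, i ∈ M → j ∈ M → k ∈ M → WP X Φ (v ++ z ++ u) i j →
      WP X Φ (v ++ z ++ u) i k → j = k := by
  classical
  have hcard : ∀ k ∈ M, (M.erase k).card < M.card := fun k hk => Finset.card_erase_lt_of_mem hk
  have huse : ∀ m ∈ M, (∃ a, WP X Φ u a m) ∧ ∃ b, WP X Φ v m b := by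
    intro m hm
    by_contra hcon
    refine absurd (hmin u v (M.erase m) ⟨hg.1, fun a b hab => ?_⟩) (not_le.2 (hcard m hm))
    obtain ⟨r, hr, h1, h2⟩ := hg.2 a b hab
    refine ⟨r, Finset.mem_erase.2 ⟨?_, hr⟩, h1, h2⟩
    rintro rfl
    exact hcon ⟨⟨a, h1⟩, b, h2⟩
  refine ⟨huse, ?_⟩
  have main := functional_of_min M
    (fun R => ∃ z, R = fun a b => a ∈ M ∧ b ∈ M ∧ WP X Φ (v ++ z ++ u) a b) ?_ ?_ ?_ ?_
  · intro z i j k hi hj hk h1 h2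
    exact main _ ⟨z, rfl⟩ i j k ⟨hi, hj, h1⟩ ⟨hi, hk, h2⟩
  · rintro _ _ ⟨z, rfl⟩ ⟨z', rfl⟩
    refine ⟨z ++ (u ++ v) ++ z', ?_⟩
    funext a b
    apply propext
    constructor
    · rintro ⟨c, ⟨ha, hc, h1⟩, -, hb, h2⟩
      refine ⟨ha, hb, ?_⟩
      have := (WP_append _ _ a b).2 ⟨c, h1, h2⟩
      simpa only [List.append_assoc] using this
    · rintro ⟨ha, hb, h⟩
      rw [show v ++ (z ++ (u ++ v) ++ z') ++ u = (v ++ z) ++ ((u ++ v) ++ (z' ++ u)) by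
        simp only [List.append_assoc]] at h
      obtain ⟨c, h1, h2⟩ := (WP_append _ _ _ _).1 h
      obtain ⟨d, h3, h4⟩ := (WP_append _ _ _ _).1 h2
      obtain ⟨m, hm, h5, h6⟩ := hg.2 c d h3
      refine ⟨m, ⟨ha, hm, (WP_append _ _ _ _).2 ⟨c, h1, h5⟩⟩, hm, hb, ?_⟩
      rw [List.append_assoc]
      exact (WP_append _ _ _ _).2 ⟨d, h6, h4⟩
  · rintro _ ⟨z, rfl⟩ a b ⟨h1, h2, -⟩
    exact ⟨h1, h2⟩
  · intro m hm m' hm'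
    obtain ⟨-, b, hb⟩ := huse m hm
    obtain ⟨⟨a, ha⟩, -⟩ := huse m' hm'
    obtain ⟨z, hz⟩ := irr_word hirr Φ hb.occ_right ha.occ_left
    exact ⟨_, ⟨z, rfl⟩, hm, hm',
      (WP_append _ _ _ _).2 ⟨a, (WP_append _ _ _ _).2 ⟨b, hb, hz⟩, ha⟩⟩
  · rintro E ⟨z, hE⟩ hidem ⟨p, q, hpq⟩ k hk hcon
    have hEW : ∀ a b, E a b → a ∈ M ∧ b ∈ M ∧ WP X Φ (v ++ z ++ u) a b := by
      intro a b h
      rwa [hE] at h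
    have hWE : ∀ a b, a ∈ M → b ∈ M → WP X Φ (v ++ z ++ u) a b → E a b := by
      intro a b h1 h2 h3
      rw [hE]
      exact ⟨h1, h2, h3⟩
    refine absurd (hmin (u ++ (v ++ z ++ u)) ((v ++ z ++ u) ++ v) (M.erase k) ⟨?_, ?_⟩)
      (not_le.2 (hcard k hk))
    · rw [← hidem] at hpq
      obtain ⟨r, h1, h2⟩ := hpq
      obtain ⟨hp, hr, h1⟩ := hEW _ _ h1
      obtain ⟨-, hq, h2⟩ := hEW _ _ h2
      obtain ⟨⟨a, ha⟩, -⟩ := huse p hp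
      obtain ⟨-, b, hb⟩ := huse q hq
      exact ⟨a, b, (WP_append _ _ _ _).2 ⟨r, (WP_append _ _ _ _).2 ⟨p, ha, h1⟩,
        (WP_append _ _ _ _).2 ⟨q, h2, hb⟩⟩⟩
    · intro a b hab
      rw [show u ++ (v ++ z ++ u) ++ (v ++ z ++ u ++ v) =
        (u ++ v) ++ (z ++ ((u ++ v) ++ (z ++ (u ++ v)))) by
          simp only [List.append_assoc]] at hab
      obtain ⟨c1, h1, hab⟩ := (WP_append _ _ _ _).1 hab
      obtain ⟨c2, h2, hab⟩ := (WP_append _ _ _ _).1 hab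
      obtain ⟨c3, h3, hab⟩ := (WP_append _ _ _ _).1 hab
      obtain ⟨c4, h4, h5⟩ := (WP_append _ _ _ _).1 hab
      obtain ⟨m1, hm1, e1, f1⟩ := hg.2 _ _ h1
      obtain ⟨m2, hm2, e2, f2⟩ := hg.2 _ _ h3
      obtain ⟨m3, hm3, e3, f3⟩ := hg.2 _ _ h5
      have g1 : E m1 m2 := hWE _ _ hm1 hm2
        ((WP_append _ _ _ _).2 ⟨c2, (WP_append _ _ _ _).2 ⟨c1, f1, h2⟩, e2⟩)
      have g2 : E m2 m3 := hWE _ _ hm2 hm3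
        ((WP_append _ _ _ _).2 ⟨c4, (WP_append _ _ _ _).2 ⟨c3, f2, h4⟩, e3⟩)
      have g3 : E m1 m3 := by
        rw [← hidem]
        exact ⟨m2, g1, g2⟩
      obtain ⟨r, hr, hrk, k1, k2⟩ := hcon _ _ g3
      exact ⟨r, Finset.mem_erase.2 ⟨hrk, hr⟩,
        (WP_append _ _ _ _).2 ⟨m1, e1, (hEW _ _ k1).2.2⟩,
        (WP_append _ _ _ _).2 ⟨m3, (hEW _ _ k2).2.2, f3⟩⟩

end Helpers

theorem mutually_separated_of_distinct_classes [Fintype A] [TopologicalSpace A] [DiscreteTopology A]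
    [Fintype B] [TopologicalSpace B] [DiscreteTopology B]
    (X : Set (ℤ → A)) (Y : Set (ℤ → B)) (π : (ℤ → A) → ℤ → B)
    (hT : FactorTriple X Y π) (hXirr : IrreducibleSubshift X)
    (hX1 : IsOneStep X) (hπ1 : IsOneBlock π)
    (y : ℤ → B) (hy : RightTransitive Y y)
    (x x' : ℤ → A) (hx : x ∈ X) (hx' : x' ∈ X)
    (hpx : π x = y) (hpx' : π x' = y) (hne : ¬ TransEquiv X π x x') :
    MutuallySeparated x x' := by
  obtain ⟨Φ, hΦ⟩ := hπ1
  have hπ : ∀ z, π z = fun i => Φ (z i) := fun z => funext (hΦ z)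
  intro i hi
  apply hne
  obtain ⟨u, v, M, hg, hmin⟩ := exists_min_good Φ ⟨x, hx⟩
  obtain ⟨huse, hfun⟩ := good_functional hXirr Φ hg hmin
  -- occurrences of `u ++ v` arbitrarily far to the right
  have hocc : ∀ K : ℤ, ∃ s : ℤ, K ≤ s ∧ yw y s (u ++ v).length = u ++ v := by
    intro K
    obtain ⟨a, b, hab⟩ := hg.1
    obtain ⟨xa, hxa, ia, rfl⟩ := hab.occ_left
    obtain ⟨xb, hxb, ib, rfl⟩ := hab.occ_right
    obtain ⟨z, hz, -, hzw, -⟩ := point_of_WP hX1 _ xa xb hxa hxb ia ib hab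
    have hz' : shiftMap (ia - K) z ∈ X := hX1.1.2 _ _ hz
    obtain ⟨n, hn, hyn⟩ := hy.2 _ (hT.2.2.2.1 _ hz') (K.natAbs + (u ++ v).length)
    refine ⟨K + n, by omega, ?_⟩
    refine Eq.trans (yw_congr _ _ _ _ _ ?_) hzw
    intro j h1 h2
    have := hyn (K + j) (by rw [abs_le, Nat.cast_add]; constructor <;> omega)
    rw [show K + n + j = K + j + n by ring, this, hπ]
    simp only [shiftMap]
    congr 2
    ring
  -- one-sided claim
  have claim : ∀ x x' : ℤ → A, x ∈ X → x' ∈ X → π x = y → π x' = y → x i = x' i →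
      TransitionTo X π x x' := by
    intro x x' hx hx' hpx hpx' hi n
    obtain ⟨s, hs, hw⟩ := hocc (max n i)
    have hyx : y = fun i => Φ (x i) := by rw [← hpx, hπ]
    have hyx' : y = fun i => Φ (x' i) := by rw [← hpx', hπ]
    obtain ⟨d, rfl⟩ : ∃ d : ℕ, s = i + d := ⟨(s - i).toNat, by omega⟩
    have p1 := WP_of_point (Φ := Φ) hx (i + d) (u ++ v).length
    have p2 := WP_of_point (Φ := Φ) hx' (i + d) (u ++ v).length
    rw [← hyx, hw] at p1
    rw [← hyx', hw] at p2
    obtain ⟨m, hm, q1, q2⟩ := hg.2 _ _ p1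
    obtain ⟨m', hm', q1', q2'⟩ := hg.2 _ _ p2
    have r1 := WP_of_point (Φ := Φ) hx i d
    have r2 := WP_of_point (Φ := Φ) hx' i d
    rw [← hyx] at r1
    rw [← hyx', ← hi] at r2
    obtain ⟨b, hb⟩ := (huse m hm).2
    obtain ⟨z0, hz0⟩ := irr_word hXirr Φ hb.occ_right r1.occ_left
    have hmm : m = m' := by
      refine hfun (z0 ++ yw y i d) m m m' hm hm hm' ?_ ?_
      · exact (WP_append _ _ _ _).2 ⟨_, (WP_append _ _ _ _).2
          ⟨b, hb, (WP_append _ _ _ _).2 ⟨_, hz0, r1⟩⟩, q1⟩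
      · exact (WP_append _ _ _ _).2 ⟨_, (WP_append _ _ _ _).2
          ⟨b, hb, (WP_append _ _ _ _).2 ⟨_, hz0, r2⟩⟩, q1'⟩
    subst hmm
    obtain ⟨z, hz, k1, k2, k3⟩ := point_of_WP hX1 _ x x' hx hx' (i + d)
      (i + d + (u ++ v).length) ((WP_append _ _ _ _).2 ⟨m, q1, q2'⟩)
    have k3' : ∀ t, i + d + (u ++ v).length ≤ t → z t = x' t := by
      intro t ht
      rw [k3 t ht]
      congr 1
      ring
    refine ⟨z, hz, ?_, fun t ht => k1 t (by omega), i + d + (u ++ v).length, by omega, k3'⟩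
    rw [hpx, hπ]
    funext t
    by_cases h1 : t ≤ i + d
    · rw [k1 t h1, hyx]
    · by_cases h2 : i + d + (u ++ v).length ≤ t
      · rw [k3' t h2, hyx']
      · exact yw_inj _ y _ _ (k2.trans hw.symm) t (by omega) (by omega)
  exact ⟨claim x x' hx hx' hpx hpx' hi, claim x' x hx' hx hpx' hpx hi.symm⟩
end

section
/- Let (X, Y, π) be an irreducible factor triple. Then there exists c > 0 such that whenever y ∈ Y is right transitive and x, x̄ are points from two distinct transition classes over y, the distance d(x, x̄) > c (in the standard metric on X). -/
open Set

universe u v uc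

variable {A : Type u} {B : Type v}

/-- Binary relations on `S`, as a monoid under composition. -/
structure BRel (S : Type*) where
  rel : S → S → Prop

namespace BRel

variable {S : Type*}

theorem ext' {R Q : BRel S} (h : ∀ a b, R.rel a b ↔ Q.rel a b) : R = Q := by
  cases R; cases Q
  congr
  funext a b
  exact propext (h a b)

instance : Monoid (BRel S) where
  mul R Q := ⟨fun a c => ∃ b, R.rel a b ∧ Q.rel b c⟩
  one := ⟨fun a b => a = b⟩
  mul_assoc R Q P := by
    apply ext'
    intro a d
    constructor
    · rintro ⟨c, ⟨b, h1, h2⟩, h3⟩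
      exact ⟨b, h1, c, h2, h3⟩
    · rintro ⟨b, h1, c, h2, h3⟩
      exact ⟨c, ⟨b, h1, h2⟩, h3⟩
  one_mul R := by
    apply ext'
    intro a b
    constructor
    · rintro ⟨c, h1, h2⟩
      have h1 : a = c := h1
      exact h1 ▸ h2
    · intro h
      exact ⟨a, rfl, h⟩
  mul_one R := by
    apply ext'
    intro a b
    constructor
    · rintro ⟨c, h1, h2⟩
      have h2 : c = b := h2
      exact h2 ▸ h1
    · intro h
      exact ⟨b, h, rfl⟩

theorem mul_rel (R Q : BRel S) (a c : S) :
    (R * Q).rel a c ↔ ∃ b, R.rel a b ∧ Q.rel b c := Iff.rfl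

theorem one_rel (a b : S) : (1 : BRel S).rel a b ↔ a = b := Iff.rfl

instance [Finite S] : Finite (BRel S) :=
  Finite.of_injective (fun R : BRel S => R.rel) (by
    intro R Q h
    cases R; cases Q
    congr)

theorem pow_diag {R : BRel S} {a : S} (h : R.rel a a) (n : ℕ) : (R ^ n).rel a a := by
  induction n with
  | zero => rw [pow_zero]; rfl
  | succ n ih => rw [pow_succ]; exact ⟨a, ih, h⟩

end BRel

/-- In a finite monoid every element has an idempotent positive power. -/
theorem exists_idem_pow {M : Type*} [Monoid M] [Finite M] (s : M) :
    ∃ n : ℕ, 0 < n ∧ s ^ n * s ^ n = s ^ n := by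
  obtain ⟨i, j, hij, h⟩ := Finite.exists_ne_map_eq_of_infinite (fun n : ℕ => s ^ (n + 1))
  replace h : s ^ (i + 1) = s ^ (j + 1) := h
  wlog hlt : i < j generalizing i j
  · exact this j i hij.symm h.symm (by omega)
  obtain ⟨d, rfl⟩ := Nat.exists_eq_add_of_lt hlt
  set p := d + 1 with hp
  have h1 : ∀ m, i + 1 ≤ m → s ^ (m + p) = s ^ m := by
    intro m hm
    obtain ⟨t, rfl⟩ := Nat.exists_eq_add_of_le hm
    have e1 : i + 1 + t + p = (i + d + 1 + 1) + t := by omega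
    rw [e1, pow_add, ← h, ← pow_add]
  have h2 : ∀ q m, i + 1 ≤ m → s ^ (m + q * p) = s ^ m := by
    intro q
    induction q with
    | zero => intro m _; simp
    | succ q ih =>
      intro m hm
      have e1 : m + (q + 1) * p = (m + q * p) + p := by ring
      rw [e1, h1 _ (by omega), ih m hm]
  refine ⟨(i + 1) * p, by positivity, ?_⟩
  rw [← pow_add]
  exact h2 _ _ (Nat.le_mul_of_pos_right _ (by omega))

/-- A `J`-minimal element of a nonempty subset of a finite monoid. -/
theorem exists_J_minimal {M : Type*} [Monoid M] [Finite M] (C : Set M) (hC : C.Nonempty) :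
    ∃ R ∈ C, ∀ P ∈ C, (∃ U V, P = U * R * V) → ∃ U V, R = U * P * V := by
  classical
  let I : M → Set M := fun R => {P | P ∈ C ∧ ∃ U V, P = U * R * V}
  obtain ⟨R, hR, hmin⟩ := Set.exists_min_image C (fun R => (I R).ncard) C.toFinite hC
  refine ⟨R, hR, fun P hP ⟨U, V, hUV⟩ => ?_⟩
  have hsub : I P ⊆ I R := by
    rintro Q ⟨hQ, U', V', h⟩
    exact ⟨hQ, U' * U, V * V', by rw [h, hUV]; simp only [mul_assoc]⟩
  have heq : I P = I R := Set.eq_of_subset_of_ncard_le hsub (hmin P hP) (Set.toFinite _)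
  have : R ∈ I R := ⟨hR, 1, 1, by simp⟩
  rw [← heq] at this
  exact this.2

/-- If `s ∈ e M e` and `e ∈ M s M` with `e` idempotent and `M` finite, then `s ^ n = e`. -/
theorem pow_eq_idem {M : Type*} [Monoid M] [Finite M] {e s U V : M}
    (hes : e * s = s) (hse : s * e = s) (h : e = U * s * V) :
    ∃ n : ℕ, s ^ (n + 1) = e := by
  have h1 : ∀ n : ℕ, e = (U * s) ^ n * e * V ^ n := by
    intro n
    induction n with
    | zero => simp
    | succ n ih =>
      have : (U * s) ^ (n + 1) * e * V ^ (n + 1) = (U * s) ^ n * (U * (s * e) * V) * V ^ n := by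
        rw [pow_succ, pow_succ']; simp only [mul_assoc]
      rw [this, hse, ← h, ← ih]
  obtain ⟨n, hn, hid⟩ := exists_idem_pow (U * s)
  obtain ⟨n, rfl⟩ := Nat.exists_eq_add_of_lt hn
  rw [zero_add] at hid
  have hfe : (U * s) ^ (n + 1) * e = (U * s) ^ (n + 1) := by
    rw [pow_succ, mul_assoc, mul_assoc, hse]
  have hfe' : (U * s) ^ (n + 1) * e = e := by
    conv_lhs => rw [h1 (n + 1)]
    rw [← mul_assoc, ← mul_assoc, hid, ← h1 (n + 1)]
  have hxs : (U * s) ^ n * U * s = e := by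
    rw [mul_assoc, ← pow_succ, ← hfe, hfe']
  set x := (U * s) ^ n * U with hx
  have h2 : ∀ m : ℕ, x ^ (m + 1) * s ^ (m + 1) = e := by
    intro m
    induction m with
    | zero => simpa using hxs
    | succ m ih =>
      have : x ^ (m + 1 + 1) * s ^ (m + 1 + 1) = x ^ (m + 1) * ((x * s) * s) * s ^ m := by
        rw [pow_succ x, pow_succ' s (m + 1), pow_succ' s m]; simp only [mul_assoc]
      rw [this, hxs, hes, mul_assoc, ← pow_succ', ih]
  obtain ⟨m, hm, hid2⟩ := exists_idem_pow s
  obtain ⟨m, rfl⟩ := Nat.exists_eq_add_of_lt hm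
  rw [zero_add] at hid2
  refine ⟨m, ?_⟩
  have h3 : e * s ^ (m + 1) = e := by
    conv_lhs => rw [← h2 m]
    rw [mul_assoc, hid2, h2 m]
  rw [← h3, pow_succ', ← mul_assoc, hes]

/-- An idempotent relation on a finite type factors through its diagonal. -/
theorem idem_factor {S : Type*} [Finite S] {e : BRel S} (he : e * e = e) {a b : S}
    (hab : e.rel a b) : ∃ c, e.rel a c ∧ e.rel c c ∧ e.rel c b := by
  by_contra hcon
  push Not at hcon
  have htr : ∀ {x y z}, e.rel x y → e.rel y z → e.rel x z := by
    intro x y z h1 h2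
    rw [← he]; exact ⟨y, h1, h2⟩
  have hd : ∀ {x z}, e.rel x z → ∃ y, e.rel x y ∧ e.rel y z := by
    intro x z h
    rw [← he] at h; exact h
  let Z := {c : S // e.rel a c ∧ e.rel c b}
  let r : Z → Z → Prop := fun c d => e.rel d.1 c.1
  have : IsTrans Z r := ⟨fun x y z h1 h2 => htr h2 h1⟩
  have : Std.Irrefl r := ⟨fun x h => hcon x.1 x.2.1 h x.2.2⟩
  have wf : WellFounded r := Finite.wellFounded_of_trans_of_irrefl r
  obtain ⟨c, hc⟩ := hd hab
  obtain ⟨m, -, hm⟩ := wf.has_min Set.univ ⟨(⟨c, hc⟩ : Z), trivial⟩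
  obtain ⟨d, h1, h2⟩ := hd m.2.2
  exact hm ⟨d, htr m.2.1 h1, h2⟩ trivial h1

/-- The combinatorial core. -/
theorem relation_core {S : Type*} [Finite S] (C : Set (BRel S)) (hne : C.Nonempty)
    (H0 : ∀ R ∈ C, ∃ a b, R.rel a b)
    (H1 : ∀ R ∈ C, ∀ Q ∈ C, ∀ a b c, R.rel a b → Q.rel b c → R * Q ∈ C)
    (H2 : ∀ R ∈ C, ∀ R' ∈ C, ∀ a b a' b', R.rel a b → R'.rel a' b' → ∃ Q ∈ C, Q.rel b a') :
    ∃ e ∈ C, ∀ r ∈ C, ∀ a p p' q q', r.rel a p → r.rel a p' → e.rel p q → e.rel p' q' →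
      e.rel p q' := by
  obtain ⟨R, hR, hmin⟩ := exists_J_minimal C hne
  obtain ⟨a, b, hab⟩ := H0 R hR
  obtain ⟨Q, hQ, hba⟩ := H2 R hR R hR a b a b hab hab
  have hT : R * Q ∈ C := H1 R hR Q hQ a b a hab hba
  have hTa : (R * Q).rel a a := ⟨b, hab, hba⟩
  have hpow : ∀ n : ℕ, (R * Q) ^ (n + 1) ∈ C := by
    intro n
    induction n with
    | zero => simpa using hT
    | succ n ih =>
      rw [pow_succ]
      exact H1 _ ih _ hT a a a (BRel.pow_diag hTa _) hTa
  obtain ⟨n, hn, hid⟩ := exists_idem_pow (R * Q)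
  obtain ⟨n, rfl⟩ := Nat.exists_eq_add_of_lt hn
  rw [zero_add] at hid
  have heC := hpow n
  have heR : (R * Q) ^ (n + 1) = 1 * R * (Q * (R * Q) ^ n) := by
    rw [pow_succ', one_mul, mul_assoc]
  generalize (R * Q) ^ (n + 1) = e at hid heC heR
  obtain ⟨U0, V0, hRe⟩ := hmin e heC ⟨_, _, heR⟩
  have hgrp : ∀ s ∈ C, e * s = s → s * e = s → ∃ n : ℕ, s ^ (n + 1) = e := by
    intro s hs h1 h2
    have : s = 1 * R * ((Q * (R * Q) ^ n) * s) := by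
      conv_lhs => rw [← h1, heR]
      simp only [mul_assoc]
    obtain ⟨U, V, hUV⟩ := hmin s hs ⟨_, _, this⟩
    refine pow_eq_idem (U := U) (V := V * (Q * (R * Q) ^ n)) h1 h2 ?_
    have h5 : e = (U * s * V) * (Q * (R * Q) ^ n) := by rw [← hUV, heR, one_mul]
    rw [h5]; simp only [mul_assoc]
  refine ⟨e, heC, ?_⟩
  intro r hr a p p' q q' h1 h2 h3 h4
  obtain ⟨c, hpc, hcc, -⟩ := idem_factor hid h3
  obtain ⟨c', hpc', -, hcq'⟩ := idem_factor hid h4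
  obtain ⟨K, hK, hca⟩ := H2 e heC r hr c c a p hcc h1
  have hs1 : e * K ∈ C := H1 e heC K hK c c a hcc hca
  have hs2 : e * K * r ∈ C := H1 _ hs1 r hr c a p ⟨c, hcc, hca⟩ h1
  have hs3 : e * K * r * e ∈ C := H1 _ hs2 e heC c p c ⟨a, ⟨c, hcc, hca⟩, h1⟩ hpc
  have hscc : (e * K * r * e).rel c c := ⟨p, ⟨a, ⟨c, hcc, hca⟩, h1⟩, hpc⟩
  have hscc' : (e * K * r * e).rel c c' := ⟨p', ⟨a, ⟨c, hcc, hca⟩, h2⟩, hpc'⟩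
  obtain ⟨m, hm⟩ := hgrp _ hs3 (by simp only [← mul_assoc, hid]) (by rw [mul_assoc, hid])
  have hcc'e : e.rel c c' := by
    rw [← hm, pow_succ]
    exact ⟨c, BRel.pow_diag hscc m, hscc'⟩
  have hpc'2 : e.rel p c' := by rw [← hid]; exact ⟨c, hpc, hcc'e⟩
  rw [← hid]; exact ⟨c', hpc'2, hcq'⟩

def winState (L : ℕ) (x : ℤ → A) (i : ℤ) : Fin (2 * L + 1) → A :=
  fun j => x (i - (L : ℤ) + (j.1 : ℤ))

theorem winState_eq {L : ℕ} {x x' : ℤ → A} {i i' : ℤ} :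
    winState L x i = winState L x' i' ↔
      ∀ m : ℤ, -(L : ℤ) ≤ m → m ≤ L → x (i + m) = x' (i' + m) := by
  constructor
  · intro h m h1 h2
    have := congrFun h ⟨(m + L).toNat, by omega⟩
    simp only [winState] at this
    have e : (((m + L).toNat : ℕ) : ℤ) = m + L := Int.toNat_of_nonneg (by omega)
    rw [e] at this
    convert this using 2 <;> ring
  · intro h
    funext j
    have := h (j.1 - L) (by omega) (by omega)
    simp only [winState]
    convert this using 2 <;> ring

/-- Splice `x` (left of `i`) with `x'` (from `i` on). -/
def splice_s9 (x x' : ℤ → A) (i : ℤ) : ℤ → A := fun m => if m < i then x m else x' m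

theorem splice_left {L : ℕ} {x x' : ℤ → A} {i : ℤ} (h : winState L x i = winState L x' i)
    {m : ℤ} (hm : m ≤ i + L) : splice_s9 x x' i m = x m := by
  unfold splice_s9
  split_ifs with h1
  · rfl
  · have := winState_eq.1 h (m - i) (by omega) (by omega)
    rw [add_sub_cancel] at this
    exact this.symm

theorem splice_right {L : ℕ} {x x' : ℤ → A} {i : ℤ} (h : winState L x i = winState L x' i)
    {m : ℤ} (hm : i - L ≤ m) : splice_s9 x x' i m = x' m := by
  unfold splice_s9
  split_ifs with h1
  · have := winState_eq.1 h (m - i) (by omega) (by omega)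
    rw [add_sub_cancel] at this
    exact this
  · rfl

theorem splice_mem {L k : ℕ} (hk : k ≤ L) {P : (Fin k → A) → Prop} {x x' : ℤ → A} {i : ℤ}
    (h : winState L x i = winState L x' i)
    (hx : ∀ i : ℤ, P fun j => x (i + (j.1 : ℤ))) (hx' : ∀ i : ℤ, P fun j => x' (i + (j.1 : ℤ))) :
    ∀ m : ℤ, P fun j => splice_s9 x x' i (m + (j.1 : ℤ)) := by
  intro m
  by_cases hm : m + k ≤ i + L
  · have : (fun j : Fin k => splice_s9 x x' i (m + (j.1 : ℤ))) = fun j => x (m + (j.1 : ℤ)) := by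
      funext j
      exact splice_left h (by omega)
    rw [this]; exact hx m
  · have : (fun j : Fin k => splice_s9 x x' i (m + (j.1 : ℤ))) = fun j => x' (m + (j.1 : ℤ)) := by
      funext j
      exact splice_right h (by omega)
    rw [this]; exact hx' m

structure GlueData (L : ℕ) (X : Set (ℤ → A)) (π : (ℤ → A) → ℤ → B) : Prop where
  shift_mem : ∀ n : ℤ, ∀ x ∈ X, shiftMap n x ∈ X
  shift_pi : ∀ (n : ℤ) (x : ℤ → A) (m : ℤ), π (shiftMap n x) m = π x (m + n)
  glue_mem : ∀ x ∈ X, ∀ x' ∈ X, ∀ i, winState L x i = winState L x' i → splice_s9 x x' i ∈ X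
  glue_left : ∀ x x' : ℤ → A, ∀ i, winState L x i = winState L x' i →
    ∀ m ≤ i, π (splice_s9 x x' i) m = π x m
  glue_right : ∀ x x' : ℤ → A, ∀ i, winState L x i = winState L x' i →
    ∀ m, i ≤ m → π (splice_s9 x x' i) m = π x' m

def reachRel (L : ℕ) (X : Set (ℤ → A)) (π : (ℤ → A) → ℤ → B) (y : ℤ → B) (i j : ℤ) :
    BRel (Fin (2 * L + 1) → A) :=
  ⟨fun s t => ∃ x ∈ X, (∀ m, i ≤ m → m ≤ j → π x m = y m) ∧ winState L x i = s ∧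
    winState L x j = t⟩

theorem winState_shift (L : ℕ) (x : ℤ → A) (n i : ℤ) :
    winState L (shiftMap n x) i = winState L x (i + n) := by
  rw [winState_eq]
  intro m _ _
  simp only [shiftMap]
  congr 1; ring

theorem winState_splice_left {L : ℕ} {x x' : ℤ → A} {i : ℤ}
    (h : winState L x i = winState L x' i) {j : ℤ} (hj : j ≤ i) :
    winState L (splice_s9 x x' i) j = winState L x j :=
  winState_eq.2 fun _ _ _ => splice_left h (by omega)

theorem winState_splice_right {L : ℕ} {x x' : ℤ → A} {i : ℤ}
    (h : winState L x i = winState L x' i) {j : ℤ} (hj : i ≤ j) :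
    winState L (splice_s9 x x' i) j = winState L x' j :=
  winState_eq.2 fun _ _ _ => splice_right h (by omega)

theorem reachRel_mono {L : ℕ} {X : Set (ℤ → A)} {π : (ℤ → A) → ℤ → B} (G : GlueData L X π)
    {y y' : ℤ → B} {i j n : ℤ} (h : ∀ m, i ≤ m → m ≤ j → y' (m + n) = y m) {a b}
    (hab : (reachRel L X π y i j).rel a b) : (reachRel L X π y' (i + n) (j + n)).rel a b := by
  obtain ⟨x, hx, hy, h1, h2⟩ := hab
  refine ⟨shiftMap (-n) x, G.shift_mem _ x hx, ?_, ?_, ?_⟩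
  · intro m hm hm'
    rw [G.shift_pi, hy _ (by omega) (by omega), ← h _ (by omega) (by omega)]
    congr 1; ring
  · rw [winState_shift, ← h1]; congr 1; ring
  · rw [winState_shift, ← h2]; congr 1; ring

theorem reachRel_congr {L : ℕ} {X : Set (ℤ → A)} {π : (ℤ → A) → ℤ → B} (G : GlueData L X π)
    {y y' : ℤ → B} {i j n : ℤ} (h : ∀ m, i ≤ m → m ≤ j → y' (m + n) = y m) :
    reachRel L X π y' (i + n) (j + n) = reachRel L X π y i j := by
  apply BRel.ext'
  intro a b
  refine ⟨fun hab => ?_, reachRel_mono G h⟩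
  have := reachRel_mono (y' := y) (n := -n) G (by
    intro m h1 h2
    have := h (m + -n) (by omega) (by omega)
    rw [← this]; congr 1; ring) hab
  simpa using this

theorem reachRel_mul {L : ℕ} {X : Set (ℤ → A)} {π : (ℤ → A) → ℤ → B} (G : GlueData L X π)
    (y : ℤ → B) {i j k : ℤ} (hij : i ≤ j) (hjk : j ≤ k) :
    reachRel L X π y i j * reachRel L X π y j k = reachRel L X π y i k := by
  apply BRel.ext'
  intro a c
  constructor
  · rintro ⟨b, ⟨x, hx, hy, h1, h2⟩, ⟨x', hx', hy', h1', h2'⟩⟩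
    have h : winState L x j = winState L x' j := h2.trans h1'.symm
    refine ⟨splice_s9 x x' j, G.glue_mem x hx x' hx' j h, ?_, ?_, ?_⟩
    · intro m hm hm'
      rcases le_total m j with hmj | hmj
      · rw [G.glue_left x x' j h m hmj]; exact hy m hm hmj
      · rw [G.glue_right x x' j h m hmj]; exact hy' m hmj hm'
    · rw [winState_splice_left h hij, h1]
    · rw [winState_splice_right h hjk, h2']
  · rintro ⟨x, hx, hy, h1, h2⟩
    exact ⟨winState L x j, ⟨x, hx, fun m hm hm' => hy m hm (by omega), h1, rfl⟩,
      ⟨x, hx, fun m hm hm' => hy m (by omega) hm', rfl, h2⟩⟩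

theorem reachRel_core [Finite A] [TopologicalSpace A] {L : ℕ} {X : Set (ℤ → A)}
    {π : (ℤ → A) → ℤ → B} (G : GlueData L X π) (hirr : IrreducibleSubshift X)
    (hne : X.Nonempty) :
    ∃ z ∈ X, ∃ i j : ℤ, i ≤ j ∧ ∀ w ∈ X, ∀ i' j' : ℤ, i' ≤ j' → ∀ a p p' q q',
      (reachRel L X π (π w) i' j').rel a p → (reachRel L X π (π w) i' j').rel a p' →
      (reachRel L X π (π z) i j).rel p q → (reachRel L X π (π z) i j).rel p' q' →
      (reachRel L X π (π z) i j).rel p q' := by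
  let C : Set (BRel (Fin (2 * L + 1) → A)) :=
    {R | ∃ z ∈ X, ∃ i j : ℤ, i ≤ j ∧ R = reachRel L X π (π z) i j}
  obtain ⟨x0, hx0⟩ := hne
  obtain ⟨e, ⟨z, hz, i, j, hij, rfl⟩, he⟩ := relation_core C
    ⟨_, x0, hx0, 0, 0, le_refl _, rfl⟩
    (by
      rintro R ⟨z, hz, i, j, hij, rfl⟩
      exact ⟨_, _, z, hz, fun _ _ _ => rfl, rfl, rfl⟩)
    (by
      rintro R ⟨z, hz, i, j, hij, rfl⟩ Q ⟨z', hz', i', j', hij', rfl⟩ a b c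
        ⟨x, hx, hy, h1, h2⟩ ⟨x', hx', hy', h1', h2'⟩
      have h : winState L x j = winState L (shiftMap (i' - j) x') j := by
        rw [winState_shift, h2, ← h1']; congr 1; ring
      refine ⟨splice_s9 x (shiftMap (i' - j) x') j,
        G.glue_mem x hx _ (G.shift_mem _ _ hx') j h, i, j + (j' - i'), by omega, ?_⟩
      rw [← reachRel_mul G _ hij (show j ≤ j + (j' - i') by omega)]
      congr 1
      · have := reachRel_congr G (n := 0) (i := i) (j := j) (y := π z)
          (y' := π (splice_s9 x (shiftMap (i' - j) x') j)) (by
            intro m hm hm'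
            rw [add_zero, G.glue_left _ _ _ h _ hm', hy m hm hm'])
        simpa using this.symm
      · have := reachRel_congr G (n := j - i') (i := i') (j := j') (y := π z')
          (y' := π (splice_s9 x (shiftMap (i' - j) x') j)) (by
            intro m hm hm'
            rw [G.glue_right _ _ _ h _ (by omega), G.shift_pi, ← hy' m hm hm']
            congr 1; ring)
        rw [← this]
        congr 1 <;> ring)
    (by
      rintro R ⟨z, hz, i, j, hij, rfl⟩ Q ⟨z', hz', i', j', hij', rfl⟩ a b a' b'
        ⟨x, hx, hy, h1, h2⟩ ⟨x', hx', hy', h1', h2'⟩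
      obtain ⟨v, hv, s, t, hst, hs, ht⟩ := hirr _ _ b a'
        ⟨x, hx, j - L, fun l => congrFun h2 l⟩ ⟨x', hx', i' - L, fun l => congrFun h1' l⟩
      refine ⟨_, ⟨v, hv, s + L, t + L, by omega, rfl⟩, v, hv, fun _ _ _ => rfl, ?_, ?_⟩
      · funext l
        rw [← hs l]; simp only [winState]; congr 1; ring
      · funext l
        rw [← ht l]; simp only [winState]; congr 1; ring)
  exact ⟨z, hz, i, j, hij, fun w hw i' j' hij' => he _ ⟨w, hw, i', j', hij', rfl⟩⟩

theorem transition_core {L : ℕ} {X : Set (ℤ → A)} {Y : Set (ℤ → B)}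
    {π : (ℤ → A) → ℤ → B} (G : GlueData L X π)
    (hYs : ∀ n : ℤ, ∀ y ∈ Y, shiftMap n y ∈ Y) (hXY : ∀ x ∈ X, π x ∈ Y)
    {z : ℤ → A} (hz : z ∈ X) {i j : ℤ} (hij : i ≤ j)
    (he : ∀ w ∈ X, ∀ i' j' : ℤ, i' ≤ j' → ∀ a p p' q q',
      (reachRel L X π (π w) i' j').rel a p → (reachRel L X π (π w) i' j').rel a p' →
      (reachRel L X π (π z) i j).rel p q → (reachRel L X π (π z) i j).rel p' q' →
      (reachRel L X π (π z) i j).rel p q')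
    {x x' : ℤ → A} (hx : x ∈ X) (hx' : x' ∈ X) (hy : RightTransitive Y (π x))
    (hxx' : π x' = π x) (h0 : winState L x 0 = winState L x' 0) : TransitionTo X π x x' := by
  intro n
  obtain ⟨K, hKn, hK0⟩ : ∃ K : ℤ, n ≤ K ∧ 0 ≤ K := ⟨max n 0, le_max_left _ _, le_max_right _ _⟩
  obtain ⟨t, ht0, ht⟩ := hy.2 (shiftMap (i - K) (π z)) (hYs _ _ (hXY z hz)) (K + (j - i)).toNat
  have hcast : (((K + (j - i)).toNat : ℕ) : ℤ) = K + (j - i) := Int.toNat_of_nonneg (by omega)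
  rw [hcast] at ht
  have hocc : ∀ m, i ≤ m → m ≤ j → π x (m + (K + t - i)) = π z m := by
    intro m h1 h2
    have := ht (m - i + K) (by rw [abs_le]; constructor <;> omega)
    simp only [shiftMap] at this
    convert this using 2 <;> ring
  have hrel := reachRel_congr (L := L) G hocc
  set p := K + t with hp
  set q := j + (p - i) with hq
  have hip : i + (p - i) = p := by ring
  rw [hip] at hrel
  have hxr := he x hx 0 p (by omega) (winState L x 0) (winState L x p) (winState L x' p)
    (winState L x q) (winState L x' q) ⟨x, hx, fun _ _ _ => rfl, rfl, rfl⟩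
    ⟨x', hx', fun m _ _ => by rw [hxx'], h0.symm, rfl⟩
    (by rw [← hrel]; exact ⟨x, hx, fun _ _ _ => rfl, rfl, rfl⟩)
    (by rw [← hrel]; exact ⟨x', hx', fun m _ _ => by rw [hxx'], rfl, rfl⟩)
  rw [← hrel] at hxr
  obtain ⟨v, hv, hvy, hv1, hv2⟩ := hxr
  have hpq : p ≤ q := by omega
  have g1 : winState L x p = winState L v p := hv1.symm
  have g2 : winState L (splice_s9 x v p) q = winState L x' q := by
    rw [winState_splice_right g1 hpq, hv2]
  refine ⟨splice_s9 (splice_s9 x v p) x' q, G.glue_mem _ (G.glue_mem x hx v hv p g1) _ hx' q g2,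
    ?_, ?_, q, by omega, ?_⟩
  · funext m
    rcases le_total m q with hmq | hmq
    · rw [G.glue_left _ _ _ g2 m hmq]
      rcases le_total m p with hmp | hmp
      · rw [G.glue_left _ _ _ g1 m hmp]
      · rw [G.glue_right _ _ _ g1 m hmp, hvy m hmp hmq]
    · rw [G.glue_right _ _ _ g2 m hmq, hxx']
  · intro m hm
    rw [splice_left g2 (by omega), splice_left g1 (by omega)]
  · intro m hm
    exact splice_right g2 (by omega)

theorem winState_of_dist {L : ℕ} {x x' : ℤ → A}
    (h : shiftDist x x' ≤ (2 : ℝ) ^ (-((L : ℤ) + 1))) : winState L x 0 = winState L x' 0 := by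
  classical
  by_cases hxx : x = x'
  · rw [hxx]
  unfold shiftDist at h
  rw [if_neg hxx] at h
  simp only at h
  rw [zpow_le_zpow_iff_right₀ (by norm_num)] at h
  rw [winState_eq]
  intro m h1 h2
  have hm : m.natAbs ∉ {k : ℕ | x (k : ℤ) ≠ x' (k : ℤ) ∨ x (-(k : ℤ)) ≠ x' (-(k : ℤ))} :=
    Nat.notMem_of_lt_sInf (by omega)
  simp only [mem_setOf_eq, not_or, not_not] at hm
  rw [zero_add]
  rcases le_total 0 m with hm0 | hm0
  · have e : (m.natAbs : ℤ) = m := by omega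
    rw [e] at hm; exact hm.1
  · have e : -(m.natAbs : ℤ) = m := by omega
    rw [e] at hm; exact hm.2

theorem glueData_of {k r : ℕ} {P : (Fin k → A) → Prop} {X : Set (ℤ → A)}
    {π : (ℤ → A) → ℤ → B} {Φ : (Fin (2 * r + 1) → A) → B}
    (hs : ∀ n : ℤ, ∀ x ∈ X, shiftMap n x ∈ X)
    (hX : X = {x | ∀ i : ℤ, P fun j => x (i + (j.1 : ℤ))})
    (hΦ : ∀ x i, π x i = Φ fun j => x (i - (r : ℤ) + (j.1 : ℤ))) : GlueData (k + r) X π where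
  shift_mem := hs
  shift_pi n x m := by
    rw [hΦ, hΦ]
    congr 1
    funext j
    simp only [shiftMap]
    congr 1; ring
  glue_mem x hx x' hx' i h := by
    subst hX
    exact splice_mem (by omega) h hx hx'
  glue_left x x' i h m hm := by
    rw [hΦ, hΦ]
    congr 1
    funext j
    exact splice_left h (by push_cast; omega)
  glue_right x x' i h m hm := by
    rw [hΦ, hΦ]
    congr 1
    funext j
    exact splice_right h (by push_cast; omega)

theorem distinct_classes_uniformly_separated [Fintype A] [TopologicalSpace A] [DiscreteTopology A]
    [Fintype B] [TopologicalSpace B] [DiscreteTopology B]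
    (X : Set (ℤ → A)) (Y : Set (ℤ → B)) (π : (ℤ → A) → ℤ → B)
    (hT : FactorTriple X Y π) (hXirr : IrreducibleSubshift X) :
    ∃ c : ℝ, 0 < c ∧ ∀ y : ℤ → B, RightTransitive Y y →
      ∀ x x' : ℤ → A, x ∈ X → x' ∈ X → π x = y → π x' = y →
        ¬ TransEquiv X π x x' → c < shiftDist x x' := by
  obtain ⟨⟨⟨_, hs⟩, k, P, hX⟩, ⟨_, hYs⟩, ⟨r, Φ, hΦ⟩, hXY, _⟩ := hT
  have G : GlueData (k + r) X π := glueData_of hs hX hΦ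
  rcases X.eq_empty_or_nonempty with hemp | hne
  · refine ⟨1, one_pos, fun y _ x x' hx => ?_⟩
    rw [hemp] at hx
    exact hx.elim
  obtain ⟨z, hz, i, j, hij, he⟩ := reachRel_core G hXirr hne
  refine ⟨(2 : ℝ) ^ (-(((k + r : ℕ) : ℤ) + 1)), by positivity, ?_⟩
  intro y hy x x' hx hx' hxy hx'y hnot
  by_contra hle
  have h0 := winState_of_dist (not_lt.1 hle)
  apply hnot
  exact ⟨transition_core G hYs hXY hz hij he hx hx' (hxy ▸ hy) (hx'y.trans hxy.symm) h0,
    transition_core G hYs hXY hz hij he hx' hx (hx'y ▸ hy) (hxy.trans hx'y.symm) h0.symm⟩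
end

section
/- Let (X, Y, π) be an irreducible factor triple and y a right transitive point of Y. Then each transition class over y is a closed subset of X in the product topology. -/
open Set

universe u v uc

variable {A : Type u} {B : Type v}

namespace TC

variable {L : ℕ}

/-- The `L`-block of `x` starting at `t`. -/
def st (L : ℕ) (x : ℤ → A) (t : ℤ) : Fin L → A := fun j => x (t + (j.1 : ℤ))

/-- Points all of whose blocks satisfy the time dependent condition `G`. -/
def Fib (G : ℤ → (Fin L → A) → Prop) : Set (ℤ → A) := {x | ∀ t, G t (st L x t)}

def Tr (G : ℤ → (Fin L → A) → Prop) (x x' : ℤ → A) : Prop :=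
  ∀ n : ℤ, ∃ z ∈ Fib G, (∀ t ≤ n, st L z t = st L x t) ∧ ∃ i : ℤ, ∀ t, i ≤ t → st L z t = st L x' t

theorem splice (x x' : ℤ → A) (i : ℤ) (h : st L x i = st L x' i) :
    ∃ z, (∀ t ≤ i, st L z t = st L x t) ∧ (∀ t, i ≤ t → st L z t = st L x' t) := by
  refine ⟨fun t => if t < i then x t else x' t, ?_, ?_⟩
  · intro t ht
    funext j
    simp only [st]
    split_ifs with h1
    · rfl
    · have := congrFun h ⟨(t + j.1 - i).toNat, by have := j.2; omega⟩
      simp only [st] at this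
      rw [show i + (((t + j.1 - i).toNat : ℕ) : ℤ) = t + j.1 by omega] at this
      exact this.symm
  · intro t ht
    funext j
    simp only [st]
    rw [if_neg (by omega)]

theorem splice_fib {G : ℤ → (Fin L → A) → Prop} {x x' : ℤ → A} (hx : x ∈ Fib G) (hx' : x' ∈ Fib G)
    (i : ℤ) (h : st L x i = st L x' i) :
    ∃ z ∈ Fib G, (∀ t ≤ i, st L z t = st L x t) ∧ (∀ t, i ≤ t → st L z t = st L x' t) := by
  obtain ⟨z, h1, h2⟩ := splice x x' i h
  refine ⟨z, fun t => ?_, h1, h2⟩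
  rcases le_total t i with ht | ht
  · rw [h1 t ht]; exact hx t
  · rw [h2 t ht]; exact hx' t

theorem splice3 (x z x' : ℤ → A) (a b : ℤ) (hab : a ≤ b) (h : st L x a = st L z a)
    (h' : st L z b = st L x' b) :
    ∃ v, (∀ t ≤ a, st L v t = st L x t) ∧ (∀ t, a ≤ t → t ≤ b → st L v t = st L z t) ∧
      (∀ t, b ≤ t → st L v t = st L x' t) := by
  obtain ⟨v, h1, h2⟩ := splice x z a h
  obtain ⟨w, h3, h4⟩ := splice v x' b (by rw [h2 b hab, h'])
  refine ⟨w, fun t ht => ?_, fun t ht ht' => ?_, h4⟩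
  · rw [h3 t (by omega), h1 t ht]
  · rw [h3 t ht', h2 t ht]

variable {G : ℤ → (Fin L → A) → Prop}

theorem Tr.of_eventually {x x' : ℤ → A} (hx : x ∈ Fib G) (i : ℤ)
    (h : ∀ t, i ≤ t → st L x t = st L x' t) : Tr G x x' :=
  fun _ => ⟨x, hx, fun _ _ => rfl, i, h⟩

theorem Tr.trans {x y z : ℤ → A} (h : Tr G x y) (h' : Tr G y z) : Tr G x z := by
  intro n
  obtain ⟨v, hv, h1, i, h2⟩ := h n
  obtain ⟨w, hw, h3, j, h4⟩ := h' (max n i)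
  obtain ⟨u, hu, h5, h6⟩ := splice_fib hv hw (max n i)
    (by rw [h2 _ (le_max_right _ _), h3 _ le_rfl])
  refine ⟨u, hu, fun t ht => ?_, max j (max n i), fun t ht => ?_⟩
  · rw [h5 t (by omega), h1 t ht]
  · rw [h6 t (by omega), h4 t (by omega)]

theorem Tr.refl {x : ℤ → A} (hx : x ∈ Fib G) : Tr G x x := Tr.of_eventually hx 0 fun _ _ => rfl

/-- uniform bound over a finite type -/
theorem exists_ub {ι : Type*} [Finite ι] (P : ι → ℤ → Prop) (hP : ∀ i, ∃ n, ∀ m, n ≤ m → P i m) :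
    ∃ n, ∀ i m, n ≤ m → P i m := by
  choose f hf using hP
  obtain ⟨n, hn⟩ := (Set.finite_range f).bddAbove
  exact ⟨n, fun i m hm => hf i m ((hn ⟨i, rfl⟩).trans hm)⟩

theorem jump {ι : Type*} [Finite ι] (g : ι → ℤ → A) :
    ∃ n : ℤ, ∀ c c', ∀ N, n ≤ N → (∃ z ∈ Fib G, (∀ t ≤ N, st L z t = st L (g c) t) ∧ Tr G z (g c')) →
      Tr G (g c) (g c') := by
  have := exists_ub (ι := ι × ι) (fun p N =>
    (∃ z ∈ Fib G, (∀ t ≤ N, st L z t = st L (g p.1) t) ∧ Tr G z (g p.2)) → Tr G (g p.1) (g p.2)) ?_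
  · obtain ⟨n, hn⟩ := this
    exact ⟨n, fun c c' N hN => hn (c, c') N hN⟩
  · rintro ⟨c, c'⟩
    by_cases h : Tr G (g c) (g c')
    · exact ⟨0, fun _ _ _ => h⟩
    · have h0 := h
      unfold Tr at h
      push Not at h
      obtain ⟨n, hn⟩ := h
      refine ⟨n, ?_⟩
      rintro m hm ⟨z, hz, h1, h2⟩
      exfalso
      obtain ⟨w, hw, h3, i, h4⟩ := h2 n
      obtain ⟨t, ht, hne⟩ := hn w hw (fun t ht => by rw [h3 t ht, h1 t (by omega)]) i
      exact hne (h4 t ht)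

/-- two points of a family sharing a state late are equivalent -/
theorem card_bound [Finite A] {ι : Type*} [Finite ι] (g : ι → ℤ → A) (hg : ∀ c, g c ∈ Fib G)
    (hinj : ∀ c c', Tr G (g c) (g c') → Tr G (g c') (g c) → c = c') :
    Nat.card ι ≤ Nat.card (Fin L → A) := by
  obtain ⟨n, hn⟩ := jump (G := G) g
  refine Nat.card_le_card_of_injective (fun c => st L (g c) n) ?_
  have key : ∀ c c', st L (g c) n = st L (g c') n → Tr G (g c) (g c') := by
    intro c c' h
    obtain ⟨z, hz, h1, h2⟩ := splice_fib (hg c) (hg c') n h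
    exact hn c c' n le_rfl ⟨z, hz, h1, Tr.of_eventually hz n h2⟩
  exact fun c c' h => hinj c c' (key c c' h) (key c' c h.symm)

theorem exists_reps [Finite A] (G : ℤ → (Fin L → A) → Prop) :
    ∃ (ι : Type u) (_ : Fintype ι) (g : ι → ℤ → A), (∀ c, g c ∈ Fib G) ∧
      (∀ c c', Tr G (g c) (g c') → Tr G (g c') (g c) → c = c') ∧
      ∀ x ∈ Fib G, ∃ c, Tr G x (g c) ∧ Tr G (g c) x := by
  let S : Setoid (Fib G) :=
    { r := fun x x' => Tr G x.1 x'.1 ∧ Tr G x'.1 x.1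
      iseqv := ⟨fun x => ⟨Tr.refl x.2, Tr.refl x.2⟩, fun h => ⟨h.2, h.1⟩,
        fun h h' => ⟨h.1.trans h'.1, h'.2.trans h.2⟩⟩ }
  have hin : ∀ c c' : Quotient S, Tr G c.out.1 c'.out.1 → Tr G c'.out.1 c.out.1 → c = c' := by
    intro c c' h h'
    rw [← Quotient.out_eq c, ← Quotient.out_eq c']
    exact Quotient.sound ⟨h, h'⟩
  have hfin : Finite (Quotient S) := by
    by_contra hinf
    rw [not_finite_iff_infinite] at hinf
    obtain ⟨s, hs⟩ := Infinite.exists_subset_card_eq (Quotient S) (Nat.card (Fin L → A) + 1)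
    have := card_bound (G := G) (ι := s) (fun c => c.1.out.1) (fun c => c.1.out.2)
      (fun c c' h h' => Subtype.ext (hin _ _ h h'))
    simp [hs] at this
  refine ⟨Quotient S, Fintype.ofFinite _, fun c => c.out.1, fun c => c.out.2, hin, fun x hx => ?_⟩
  refine ⟨Quotient.mk S ⟨x, hx⟩, ?_⟩
  have : S.r (Quotient.mk S ⟨x, hx⟩).out ⟨x, hx⟩ := Quotient.exact (Quotient.out_eq _)
  exact ⟨this.2, this.1⟩

/-- every point can be routed through `M` at time `m` -/
def Good (G : ℤ → (Fin L → A) → Prop) (m : ℤ) (M : Set (Fin L → A)) : Prop :=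
  ∀ x ∈ Fib G, ∃ z ∈ Fib G, ∃ a b : ℤ, (∀ t ≤ a, st L z t = st L x t) ∧
    (∀ t, b ≤ t → st L z t = st L x t) ∧ st L z m ∈ M

theorem good_reps [Finite A] {ι : Type*} [Finite ι] (g : ι → ℤ → A)
    (hall : ∀ x ∈ Fib G, ∃ c, Tr G x (g c) ∧ Tr G (g c) x) :
    ∃ m₀ : ℤ, ∀ m, m₀ ≤ m → Good G m (Set.range fun c => st L (g c) m) := by
  have := exists_ub (ι := (Fin L → A) × ι) (fun p m => ∀ x ∈ Fib G, st L x 0 = p.1 →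
    Tr G x (g p.2) → ∃ z ∈ Fib G, st L z 0 = p.1 ∧ ∀ t, m ≤ t → st L z t = st L (g p.2) t) ?_
  · obtain ⟨n, hn⟩ := this
    refine ⟨max n 0, fun m hm x hx => ?_⟩
    obtain ⟨c, h1, h2⟩ := hall x hx
    obtain ⟨z, hz, h3, h4⟩ := hn (st L x 0, c) m (by omega) x hx rfl h1
    obtain ⟨w, hw, h5, i, h6⟩ := h2 m
    obtain ⟨u, hu, h7, h8⟩ := splice_fib hx hz 0 h3.symm
    obtain ⟨v, hv, h9, h10⟩ := splice_fib hu hw m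
      (by rw [h8 m (by omega), h4 m le_rfl, h5 m le_rfl])
    refine ⟨v, hv, 0, max i m, fun t ht => ?_, fun t ht => ?_, c, ?_⟩
    · rw [h9 t (by omega), h7 t ht]
    · rw [h10 t (by omega), h6 t (by omega)]
    · simp only
      rw [h10 m le_rfl, h5 m le_rfl]
  · rintro ⟨s, c⟩
    by_cases h : ∃ x ∈ Fib G, st L x 0 = s ∧ Tr G x (g c)
    · obtain ⟨x, hx, h0, h1⟩ := h
      obtain ⟨z, hz, h2, i, h3⟩ := h1 0
      exact ⟨i, fun m hm _ _ _ _ => ⟨z, hz, by rw [h2 0 le_rfl, h0], fun t ht => h3 t (by omega)⟩⟩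
    · push Not at h
      exact ⟨0, fun m _ x hx h0 h1 => absurd h1 (h x hx h0)⟩

/-- compactness -/
theorem exists_limit [Finite A] (X : ℕ → ℤ → A) :
    ∃ (U : Ultrafilter ℕ) (x : ℤ → A), (∀ n : ℕ, ∀ᶠ K in (U : Filter ℕ), n ≤ K) ∧
      ∀ t, ∀ᶠ K in (U : Filter ℕ), st L (X K) t = st L x t := by
  let U : Ultrafilter ℕ := Filter.hyperfilter ℕ
  have hx : ∀ t : ℤ, ∃ a, ∀ᶠ K in (U : Filter ℕ), X K t = a := by
    intro t
    have h := (Ultrafilter.finite_biUnion_mem_iff (f := U) (Set.finite_univ (α := A))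
      (s := fun a => {K | X K t = a})).1
      (Filter.mem_of_superset Filter.univ_mem (fun K _ => by simp))
    obtain ⟨a, _, ha⟩ := h
    exact ⟨a, ha⟩
  choose x hx using hx
  refine ⟨U, x, fun n => ?_, fun t => ?_⟩
  · have : (U : Filter ℕ) ≤ Filter.atTop := by
      rw [← Nat.cofinite_eq_atTop]; exact Filter.hyperfilter_le_cofinite
    exact this (Filter.eventually_ge_atTop n)
  · have : ∀ᶠ K in (U : Filter ℕ), ∀ j : Fin L, X K (t + (j.1 : ℤ)) = x (t + (j.1 : ℤ)) :=
      Filter.eventually_all.2 fun j => hx _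
    filter_upwards [this] with K hK
    funext j
    exact hK j

theorem good_block [Finite A] {m : ℤ} {M : Set (Fin L → A)} (h : Good G m M) :
    ∃ K : ℕ, ∀ x : ℤ → A, (∀ t : ℤ, |t| ≤ (K : ℤ) → G t (st L x t)) →
      ∃ z : ℤ → A, (∀ t : ℤ, |t| ≤ (K : ℤ) → G t (st L z t)) ∧
        (∀ t : ℤ, t ≤ -(K : ℤ) → st L z t = st L x t) ∧
        (∀ t : ℤ, (K : ℤ) ≤ t → st L z t = st L x t) ∧ st L z m ∈ M := by
  by_contra hcon
  push Not at hcon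
  choose X hX hno using hcon
  obtain ⟨U, x, hU, hlim⟩ := exists_limit (L := L) X
  have hx : x ∈ Fib G := by
    intro t
    obtain ⟨K, h1, h2⟩ := ((hU t.natAbs).and (hlim t)).exists
    rw [← h2]
    exact hX K t (abs_le.2 ⟨by omega, by omega⟩)
  obtain ⟨z, hz, a, b, h1, h2, h3⟩ := h x hx
  set a' := min a m with ha'
  set b' := max b m with hb'
  obtain ⟨K, ⟨⟨h4, h5⟩, h6⟩, h7⟩ :=
    ((((hU a'.natAbs).and (hU b'.natAbs)).and (hlim a')).and (hlim b')).exists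
  obtain ⟨v, h8, h9, h10⟩ := splice3 (L := L) (X K) z (X K) a' b' (by omega)
    (by rw [h6, h1 _ (by omega)]) (by rw [h7, h2 _ (by omega)])
  refine hno K v ?_ (fun t ht => h8 t (by omega)) (fun t ht => h10 t (by omega))
    (by rw [h9 m (by omega) (by omega)]; exact h3)
  intro t ht
  rcases le_total t a' with h | h
  · rw [h8 t h]; exact hX K t ht
  rcases le_total t b' with h' | h'
  · rw [h9 t h h']; exact hz t
  · rw [h10 t h']; exact hX K t ht

/-- `G` repeats on `[-K,K]` after shifting by `s`. -/
def Per (G : ℤ → (Fin L → A) → Prop) (K s : ℤ) : Prop :=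
  ∀ t : ℤ, |t| ≤ K → ∀ u, G (t + s) u ↔ G t u

theorem st_shift (x : ℤ → A) (s t : ℤ) : st L (fun i => x (i + s)) t = st L x (t + s) := by
  funext j
  simp only [st]
  congr 1
  omega

theorem good_shift [Finite A] {m : ℤ} {M : Set (Fin L → A)} (h : Good G m M) :
    ∃ K : ℕ, ∀ s, Per G K s → ∀ x ∈ Fib G, ∃ z ∈ Fib G,
      (∀ t : ℤ, t ≤ s - (K : ℤ) → st L z t = st L x t) ∧
        (∀ t : ℤ, s + (K : ℤ) ≤ t → st L z t = st L x t) ∧ st L z (m + s) ∈ M := by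
  obtain ⟨K, hK⟩ := good_block h
  refine ⟨K, fun s hs x hx => ?_⟩
  obtain ⟨z, h1, h2, h3, h4⟩ := hK (fun i => x (i + s)) (fun t ht => by
    rw [st_shift, ← hs t ht]; exact hx _)
  have e1 : ∀ t : ℤ, t ≤ s - (K : ℤ) → st L (fun i => z (i + -s)) t = st L x t := by
    intro t ht
    rw [st_shift, h2 _ (by omega), st_shift]; congr 1; omega
  have e2 : ∀ t : ℤ, s + (K : ℤ) ≤ t → st L (fun i => z (i + -s)) t = st L x t := by
    intro t ht
    rw [st_shift, h3 _ (by omega), st_shift]; congr 1; omega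
  refine ⟨fun i => z (i + -s), fun t => ?_, e1, e2, ?_⟩
  · by_cases ht : |t - s| ≤ (K : ℤ)
    · have := (hs (t - s) ht _).2 (h1 (t - s) ht)
      rw [st_shift, ← sub_eq_add_neg]
      simpa using this
    · rw [abs_le, not_and_or] at ht
      rcases ht with ht | ht
      · rw [e1 t (by omega)]; exact hx t
      · rw [e2 t (by omega)]; exact hx t
  · rw [st_shift, show m + s + -s = m by omega]; exact h4

/-- state `s` at time `t` is labelled by the class of `x` -/
def Lab (G : ℤ → (Fin L → A) → Prop) (s : Fin L → A) (t : ℤ) (x : ℤ → A) : Prop :=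
  (∃ z ∈ Fib G, st L z t = s ∧ Tr G z x) ∧ ∀ z ∈ Fib G, st L z t = s → Tr G x z

theorem relay {s s' : Fin L → A} {p q : ℤ} {x x' : ℤ → A} (h : Lab G s p x) (h' : Lab G s' q x')
    (hpq : p ≤ q) (v : ℤ → A) (hp : st L v p = s) (hq : st L v q = s')
    (hv : ∀ t, p ≤ t → t ≤ q → G t (st L v t)) : Tr G x x' := by
  obtain ⟨⟨z, hz, h1, h2⟩, h3⟩ := h
  obtain ⟨⟨z', hz', h1', h2'⟩, h3'⟩ := h'
  obtain ⟨w, w1, w2, w3⟩ := splice3 (L := L) z v z' p q hpq (by rw [h1, hp]) (by rw [h1', hq])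
  have hw : w ∈ Fib G := by
    intro t
    rcases le_total t p with h | h
    · rw [w1 t h]; exact hz t
    rcases le_total t q with h' | h'
    · rw [w2 t h h']; exact hv t h h'
    · rw [w3 t h']; exact hz' t
  exact (h3 w hw (by rw [w1 p le_rfl, h1])).trans ((Tr.of_eventually hw q w3).trans h2')

theorem exists_perm [Finite A] {ι : Type*} [Finite ι] (g : ι → ℤ → A) (hg : ∀ c, g c ∈ Fib G)
    (hinj : ∀ c c', Tr G (g c) (g c') → Tr G (g c') (g c) → c = c')
    (hall : ∀ x ∈ Fib G, ∃ c, Tr G x (g c) ∧ Tr G (g c) x) (m : ℤ)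
    (hm : Good G m (Set.range fun c => st L (g c) m)) :
    ∃ K N : ℤ, ∀ s, N ≤ s → ∀ K', K ≤ K' → Per G K' s → ∃ α : ι ≃ ι, ∀ d, Lab G (st L (g d) m) (m + s) (g (α d)) := by
  obtain ⟨K, hK⟩ := good_shift hm
  obtain ⟨n, hn⟩ := jump (G := G) g
  refine ⟨K, max (n + K) (n - m), fun s hs K' hK' hper => ?_⟩
  have hper' : Per G K s := fun t ht => hper t (ht.trans hK')
  choose z hz h1 h2 f hf using fun c => hK s hper' (g c) (hg c)
  simp only at hf
  have key : ∀ c, ∀ x ∈ Fib G, st L x (m + s) = st L (z c) (m + s) → Tr G (g c) x := by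
    intro c x hx h
    obtain ⟨c', hc1, hc2⟩ := hall x hx
    obtain ⟨w, hw, h3, h4⟩ := splice_fib (hz c) hx (m + s) h.symm
    refine (hn c c' n le_rfl ⟨w, hw, fun t ht => ?_,
      (Tr.of_eventually hw _ h4).trans hc1⟩).trans hc2
    rw [h3 t (by omega), h1 c t (by omega)]
  have hzg : ∀ c, Tr G (z c) (g c) := fun c => Tr.of_eventually (hz c) _ (h2 c)
  have finj : Function.Injective f := by
    intro c c' h
    have e : st L (z c) (m + s) = st L (z c') (m + s) := by rw [← hf, ← hf, h]
    exact hinj _ _ ((key c (z c') (hz c') e.symm).trans (hzg c'))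
      ((key c' (z c) (hz c) e).trans (hzg c))
  let e := Equiv.ofBijective f (Finite.injective_iff_bijective.1 finj)
  refine ⟨e.symm, fun d => ?_⟩
  have hd : st L (g d) m = st L (z (e.symm d)) (m + s) := by
    rw [← hf]; congr 2; exact (e.apply_symm_apply d).symm
  rw [hd]
  exact ⟨⟨_, hz _, rfl, hzg _⟩, fun x hx h => key _ x hx h⟩

/-- order combinatorics -/
theorem order_comb {ι : Type*} [Fintype ι] (r : ι → ι → Prop) (hrefl : ∀ c, r c c)
    (htr : ∀ a b c, r a b → r b c → r a c) (hanti : ∀ a b, r a b → r b a → a = b) :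
    ∃ h : ι → ℕ, (∀ a b, r a b → h a ≤ h b) ∧ (∀ a b, r a b → h b ≤ h a → a = b) ∧
      ∀ α β : ι ≃ ι, (∀ d d', r d d' → r (α d) (β d')) → (∀ d, h (α d) = h d) ∧ ∀ d, h (β d) = h d := by
  classical
  let D : ι → Finset ι := fun c => Finset.univ.filter fun d => r d c
  have hsub : ∀ a b, r a b → D a ⊆ D b := by
    intro a b hab d hd
    simp only [D, Finset.mem_filter, Finset.mem_univ, true_and] at hd ⊢
    exact htr _ _ _ hd hab
  have hst : ∀ a b, r a b → (D b).card ≤ (D a).card → a = b := by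
    intro a b hab hle
    have := Finset.eq_of_subset_of_card_le (hsub a b hab) hle
    refine hanti _ _ hab ?_
    have hb : b ∈ D b := by simp [D, hrefl]
    rw [← this] at hb
    simpa [D] using hb
  refine ⟨fun c => (D c).card, fun a b hab => Finset.card_le_card (hsub a b hab), hst, ?_⟩
  intro α β hαβ
  have sumeq : ∀ (α β : ι ≃ ι), (∀ d, (D (α d)).card ≤ (D (β d)).card) →
      ∀ d, (D (α d)).card = (D (β d)).card := by
    intro α β hle d
    have hs : ∑ d, (D (α d)).card = ∑ d, (D (β d)).card := by
      rw [Equiv.sum_comp α (fun d => (D d).card), Equiv.sum_comp β (fun d => (D d).card)]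
    exact (Finset.sum_eq_sum_iff_of_le (fun d _ => hle d)).1 hs d (Finset.mem_univ d)
  have h1 := sumeq α β fun d => Finset.card_le_card (hsub _ _ (hαβ d d (hrefl d)))
  have h2 : ∀ d, α d = β d := fun d => hst _ _ (hαβ d d (hrefl d)) (h1 d).ge
  have h3 := sumeq (Equiv.refl ι) α (fun d => by
    simp only [Equiv.refl_apply]
    refine Finset.card_le_card_of_injOn α ?_ α.injective.injOn
    intro e he
    simp only [D, Finset.coe_filter, Finset.mem_univ, true_and, Set.mem_ofPred_eq] at he ⊢
    rw [h2 d]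
    exact hαβ e d he)
  simp only [Equiv.refl_apply] at h3
  exact ⟨fun d => (h3 d).symm, fun d => by
    have := h1 d
    have := h3 d
    simp only
    omega⟩

/-- Recurrence and irreducibility in one hypothesis. -/
def Recur (G : ℤ → (Fin L → A) → Prop) : Prop :=
  ∀ x ∈ Fib G, ∀ x' ∈ Fib G, ∀ K N : ℤ, ∃ (w : ℤ → A) (s T : ℤ), N ≤ s ∧ K ≤ T ∧
    (∀ t : ℤ, |t| ≤ K → st L w t = st L x t) ∧ (∀ t : ℤ, |t| ≤ K → st L w (t + T) = st L x' t) ∧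
    (∀ t : ℤ, -K ≤ t → t ≤ T + K → G (t + s) (st L w t)) ∧ Per G K s ∧ Per G K (s + T)

theorem antichain [Finite A] {ι : Type*} [Fintype ι] (hR : Recur G) (g : ι → ℤ → A)
    (hg : ∀ c, g c ∈ Fib G)
    (hinj : ∀ c c', Tr G (g c) (g c') → Tr G (g c') (g c) → c = c')
    (hall : ∀ x ∈ Fib G, ∃ c, Tr G x (g c) ∧ Tr G (g c) x) (c c' : ι) (hcc : Tr G (g c) (g c')) :
    c = c' := by
  obtain ⟨h, hmono, hst, hperm⟩ := order_comb (fun c c' => Tr G (g c) (g c'))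
    (fun c => Tr.refl (hg c)) (fun _ _ _ => Tr.trans) hinj
  obtain ⟨m, hgood⟩ := good_reps g hall
  have := exists_ub (ι := ι × ι) (fun p m1 => Tr G (g p.1) (g p.2) →
    ∃ z ∈ Fib G, st L z m = st L (g p.1) m ∧ st L z m1 = st L (g p.2) m1) ?_
  swap
  · rintro ⟨d, d'⟩
    by_cases hd : Tr G (g d) (g d')
    · obtain ⟨z, hz, h1, i, h2⟩ := hd m
      exact ⟨i, fun m1 hm1 _ => ⟨z, hz, h1 m le_rfl, h2 m1 hm1⟩⟩
    · exact ⟨0, fun _ _ h => absurd h hd⟩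
  obtain ⟨n1, hn1⟩ := this
  set m1 := max n1 m with hm1
  obtain ⟨K, N, hP⟩ := exists_perm g hg hinj hall m (hgood m le_rfl)
  obtain ⟨K1, N1, hP1⟩ := exists_perm g hg hinj hall m1 (hgood m1 (by omega))
  set K' := max (max K K1) (2 * (|m| + |m1|)) with hK'
  have am := abs_le.1 (le_refl |m|)
  have am1 := abs_le.1 (le_refl |m1|)
  obtain ⟨w, s, T, hs, hT, w1, w2, w3, per1, per2⟩ :=
    hR (g c') (hg c') (g c) (hg c) K' (max N N1)
  have step : ∀ s, max N N1 ≤ s → Per G K' s → ∃ α β : ι ≃ ι,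
      (∀ d, Lab G (st L (g d) m) (m + s) (g (α d))) ∧
      (∀ d, Lab G (st L (g d) m1) (m1 + s) (g (β d))) ∧ (∀ d, h (α d) = h d) ∧ ∀ d, h (β d) = h d := by
    intro s hs per
    obtain ⟨α, hα⟩ := hP s (by omega) K' (by omega) per
    obtain ⟨β, hβ⟩ := hP1 s (by omega) K' (by omega) per
    refine ⟨α, β, hα, hβ, hperm α β ?_⟩
    intro d d' hdd
    obtain ⟨z, hz, z1, z2⟩ := hn1 (d, d') m1 (by omega) hdd
    refine relay (hα d) (hβ d') (by omega) (fun i => z (i + -s)) ?_ ?_ ?_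
    · rw [st_shift, ← z1]; congr 1; omega
    · rw [st_shift, ← z2]; congr 1; omega
    · intro t ht ht'
      rw [st_shift]
      have := (per (t + -s) (abs_le.2 ⟨by omega, by omega⟩) (st L z (t + -s))).2 (hz _)
      simpa using this
  obtain ⟨α1, β1, hα1, hβ1, hh1, hh1'⟩ := step s hs per1
  have abm := abs_nonneg m
  have abm1 := abs_nonneg m1
  obtain ⟨α2, β2, hα2, hβ2, hh2, hh2'⟩ := step (s + T) (by omega) per2
  have link : Tr G (g (β1 c')) (g (α2 c)) := by
    refine relay (hβ1 c') (hα2 c) (by omega) (fun i => w (i + -s)) ?_ ?_ ?_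
    · rw [st_shift, ← w1 m1 (by omega)]; congr 1; omega
    · rw [st_shift, ← w2 m (by omega)]; congr 1; omega
    · intro t ht ht'
      rw [st_shift]
      have := w3 (t + -s) (by omega) (by omega)
      simpa using this
  have := hmono _ _ link
  rw [hh1', hh2] at this
  exact hst _ _ hcc this

theorem share [Finite A] (hR : Recur G) {x x' : ℤ → A} (hx : x ∈ Fib G) (hx' : x' ∈ Fib G) (i : ℤ)
    (hi : st L x i = st L x' i) : Tr G x x' := by
  obtain ⟨ι, _, g, hg, hinj, hall⟩ := exists_reps G
  have hanti := antichain hR g hg hinj hall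
  obtain ⟨m₀, hgood⟩ := good_reps g hall
  obtain ⟨c, hc1, hc2⟩ := hall x hx
  obtain ⟨c', hc1', hc2'⟩ := hall x' hx'
  suffices c = c' by subst this; exact hc1.trans hc2'
  obtain ⟨z, hz, z1, j, z2⟩ := hc1 i
  obtain ⟨z', hz', z1', j', z2'⟩ := hc1' i
  set m := max (max m₀ i) (max j j') with hm
  obtain ⟨K, N, hP⟩ := exists_perm g hg hinj hall m (hgood m (by omega))
  set K' := max K (2 * (|m| + |i|)) with hK'
  have am := abs_le.1 (le_refl |m|)
  have ai := abs_le.1 (le_refl |i|)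
  have abm := abs_nonneg m
  have abi := abs_nonneg i
  obtain ⟨w, s, T, hs, hT, w1, w2, w3, per1, per2⟩ := hR z hz z hz K' N
  obtain ⟨α, hα⟩ := hP s hs K' (by omega) per1
  obtain ⟨β, hβ⟩ := hP (s + T) (by omega) K' (by omega) per2
  have sw : ∀ t, -K' + s ≤ t → t ≤ T + K' + s → G t (st L (fun i => w (i + -s)) t) := by
    intro t ht ht'
    rw [st_shift]
    have := w3 (t + -s) (by omega) (by omega)
    simpa using this
  have e0 : st L (fun i => w (i + -s)) (m + s) = st L (g c) m := by
    rw [st_shift, ← z2 m (by omega), ← w1 m (by omega)]; congr 1; omega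
  have l1 : Tr G (g (α c)) (g (β c)) := by
    refine relay (hα c) (hβ c) (by omega) (fun i => w (i + -s)) e0 ?_ ?_
    · rw [st_shift, ← z2 m (by omega), ← w2 m (by omega)]; congr 1; omega
    · exact fun t ht ht' => sw t (by omega) (by omega)
  have l2 : Tr G (g (α c)) (g (β c')) := by
    obtain ⟨v, v1, v2⟩ := splice (L := L) (fun i => w (i + -s)) (fun i => z' (i + -(s + T)))
      (i + (s + T)) (by
        rw [st_shift, st_shift, show i + (s + T) + -s = i + T by omega, w2 i (by omega),
          show i + (s + T) + -(s + T) = i by omega, z1 i le_rfl, z1' i le_rfl, hi])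
    refine relay (hα c) (hβ c') (by omega) v ?_ ?_ ?_
    · rw [v1 _ (by omega), e0]
    · rw [v2 _ (by omega), st_shift, ← z2' m (by omega)]; congr 1; omega
    · intro t ht ht'
      rcases le_total t (i + (s + T)) with h | h
      · rw [v1 t h]; exact sw t (by omega) (by omega)
      · rw [v2 t h, st_shift]
        have := (per2 (t + -(s + T)) (abs_le.2 ⟨by omega, by omega⟩) (st L z' (t + -(s + T)))).2 (hz' _)
        rwa [show t + -(s + T) + (s + T) = t by omega] at this
  exact β.injective ((hanti _ _ l1).symm.trans (hanti _ _ l2))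

end TC

namespace TC

theorem st_eq_of_agree {L : ℕ} {x x' : ℤ → A} {t : ℤ} (h : ∀ i, t ≤ i → i < t + L → x i = x' i) :
    st L x t = st L x' t := by
  funext j
  exact h _ (by omega) (by have := j.2; omega)

theorem agree_of_st {L : ℕ} {x x' : ℤ → A} {t : ℤ} (hL : 0 < L) (h : st L x t = st L x' t) :
    x t = x' t := by
  have := congrFun h ⟨0, hL⟩
  simpa [st] using this

theorem irr_points [TopologicalSpace A] {X : Set (ℤ → A)} (hs : IsSubshift X)
    (hirr : IrreducibleSubshift X) {x x' : ℤ → A} (hx : x ∈ X) (hx' : x' ∈ X) (n : ℕ) :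
    ∃ w ∈ X, ∃ T : ℤ, (n : ℤ) ≤ T ∧ (∀ t : ℤ, |t| ≤ (n : ℤ) → w t = x t) ∧
      ∀ t : ℤ, |t| ≤ (n : ℤ) → w (t + T) = x' t := by
  obtain ⟨v, hv, i, k, hik, h1, h2⟩ := hirr (2 * n + 1) (2 * n + 1)
    (fun j => x (-(n : ℤ) + j.1)) (fun j => x' (-(n : ℤ) + j.1))
    ⟨x, hx, -(n : ℤ), fun _ => rfl⟩ ⟨x', hx', -(n : ℤ), fun _ => rfl⟩
  refine ⟨shiftMap (i + n) v, hs.2 _ _ hv, k - i, by push_cast at hik; omega, ?_, ?_⟩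
  · intro t ht
    obtain ⟨ha, hb⟩ := abs_le.1 ht
    have := h1 ⟨(t + n).toNat, by omega⟩
    simp only at this
    rw [show i + (((t + n).toNat : ℕ) : ℤ) = t + (i + n) by omega,
      show -(n : ℤ) + (((t + n).toNat : ℕ) : ℤ) = t by omega] at this
    exact this
  · intro t ht
    obtain ⟨ha, hb⟩ := abs_le.1 ht
    have := h2 ⟨(t + n).toNat, by omega⟩
    simp only at this
    rw [show k + (((t + n).toNat : ℕ) : ℤ) = t + (k - i) + (i + n) by omega,
      show -(n : ℤ) + (((t + n).toNat : ℕ) : ℤ) = t by omega] at this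
    exact this

end TC

theorem transClass_isClosed [Fintype A] [TopologicalSpace A] [DiscreteTopology A]
    [Fintype B] [TopologicalSpace B] [DiscreteTopology B]
    (X : Set (ℤ → A)) (Y : Set (ℤ → B)) (π : (ℤ → A) → ℤ → B)
    (hT : FactorTriple X Y π) (hXirr : IrreducibleSubshift X)
    (y : ℤ → B) (hy : RightTransitive Y y) :
    ∀ C ∈ transClassesOver X π y, IsClosed C := by
  classical
  obtain ⟨⟨hXsub, k, P, hXP⟩, hYsub, ⟨r, Φ, hΦ⟩, hmaps, hsurj⟩ := hT
  obtain ⟨L, hL⟩ : ∃ L : ℕ, L = k + 2 * r + 1 := ⟨_, rfl⟩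
  let E : (Fin L → A) → Prop := fun u => P fun j => u ⟨j.1, by have := j.2; omega⟩
  let Ψ : (Fin L → A) → B := fun u => Φ fun j => u ⟨j.1, by have := j.2; omega⟩
  have hE : ∀ x, x ∈ X ↔ ∀ t, E (TC.st L x t) := by
    intro x
    rw [hXP]
    exact Iff.rfl
  have hΨ : ∀ x t, Ψ (TC.st L x t) = π x (t + r) := by
    intro x t
    rw [hΦ]
    simp only [Ψ, TC.st]
    congr 1
    funext j
    congr 1
    omega
  let G : ℤ → (Fin L → A) → Prop := fun t u => E u ∧ Ψ u = y (t + r)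
  have hF : ∀ x, x ∈ TC.Fib G ↔ x ∈ X ∧ π x = y := by
    intro x
    constructor
    · intro h
      refine ⟨(hE x).2 fun t => (h t).1, funext fun t => ?_⟩
      have := (h (t - r)).2
      rw [hΨ] at this
      simpa using this
    · rintro ⟨h1, h2⟩ t
      exact ⟨(hE x).1 h1 t, by rw [hΨ, h2]⟩
  -- recurrence
  have hrec : ∀ w ∈ X, ∀ K N : ℕ, ∃ s : ℤ, (N : ℤ) ≤ s ∧
      ∀ t : ℤ, |t| ≤ (K : ℤ) → y (t + s) = π w t := by
    intro w hw K N
    obtain ⟨v, hv, T, hT, h1, h2⟩ := TC.irr_points hXsub hXirr hw hw (K + N + r)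
    obtain ⟨n, hn, h3⟩ := hy.2 (π v) (hmaps v hv) (K + T.toNat)
    refine ⟨T + n, by push_cast at hT; omega, fun t ht => ?_⟩
    obtain ⟨ha, hb⟩ := abs_le.1 ht
    have := h3 (t + T) (abs_le.2 ⟨by push_cast; omega, by push_cast; omega⟩)
    rw [← add_assoc, this, hΦ, hΦ]
    congr 1
    funext j
    have hj := j.2
    rw [← h2 _ (abs_le.2 ⟨by push_cast; omega, by push_cast; omega⟩)]
    congr 1
    omega
  have hR : TC.Recur G := by
    intro x hx x' hx' K N
    obtain ⟨hxX, hxy⟩ := (hF x).1 hx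
    obtain ⟨hxX', hxy'⟩ := (hF x').1 hx'
    obtain ⟨w, hw, T, hT, h1, h2⟩ := TC.irr_points hXsub hXirr hxX hxX' (K.toNat + L)
    push_cast at hT
    obtain ⟨s, hs, h3⟩ := hrec w hw (T.toNat + K.toNat + r) N.toNat
    have s1 : ∀ t : ℤ, |t| ≤ K → TC.st L w t = TC.st L x t := by
      intro t ht
      obtain ⟨ha, hb⟩ := abs_le.1 ht
      exact TC.st_eq_of_agree fun i hi hi' =>
        h1 i (abs_le.2 ⟨by push_cast; omega, by push_cast; omega⟩)
    have s2 : ∀ t : ℤ, |t| ≤ K → TC.st L w (t + T) = TC.st L x' t := by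
      intro t ht
      obtain ⟨ha, hb⟩ := abs_le.1 ht
      rw [← TC.st_shift]
      exact TC.st_eq_of_agree fun i hi hi' =>
        h2 i (abs_le.2 ⟨by push_cast; omega, by push_cast; omega⟩)
    have s3 : ∀ t : ℤ, -K ≤ t → t ≤ T + K → Ψ (TC.st L w t) = y (t + s + r) := by
      intro t ht ht'
      rw [hΨ, ← h3 _ (abs_le.2 ⟨by push_cast; omega, by push_cast; omega⟩)]
      congr 1
      omega
    refine ⟨w, s, T, by omega, by omega, s1, s2, fun t ht ht' => ⟨(hE w).1 hw t, s3 t ht ht'⟩,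
      ?_, ?_⟩
    · intro t ht u
      obtain ⟨ha, hb⟩ := abs_le.1 ht
      have e : y (t + s + r) = y (t + r) := by
        rw [← s3 t (by omega) (by omega), s1 t ht]
        exact (hx t).2
      simp only [G, e]
    · intro t ht u
      obtain ⟨ha, hb⟩ := abs_le.1 ht
      have e : y (t + (s + T) + r) = y (t + r) := by
        rw [show t + (s + T) + r = (t + T) + s + r by omega, ← s3 (t + T) (by omega) (by omega),
          s2 t ht]
        exact (hx' t).2
      simp only [G, e]
  have hTr : ∀ x x', π x = y → (TransitionTo X π x x' ↔ TC.Tr G x x') := by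
    intro x x' hxy
    constructor
    · intro h n
      obtain ⟨z, hz, h1, h2, i, hi, h3⟩ := h (n + L)
      exact ⟨z, (hF z).2 ⟨hz, h1.trans hxy⟩,
        fun t ht => TC.st_eq_of_agree fun j hj hj' => h2 j (by omega), i,
        fun t ht => TC.st_eq_of_agree fun j hj hj' => h3 j (by omega)⟩
    · intro h n
      obtain ⟨z, hz, h1, i, h2⟩ := h n
      obtain ⟨hz1, hz2⟩ := (hF z).1 hz
      exact ⟨z, hz1, hz2.trans hxy.symm,
        fun m hm => TC.agree_of_st (L := L) (by omega) (h1 m hm), max n i, le_max_left _ _,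
        fun m hm => TC.agree_of_st (L := L) (by omega) (h2 m (by omega))⟩
  rintro C ⟨x, hxX, hxy, rfl⟩
  have near : ∀ x' ∈ closure (transClass X π x), ∀ t : ℤ,
      ∃ v ∈ transClass X π x, TC.st L v t = TC.st L x' t := by
    intro x' hx' t
    have hopen : IsOpen {v : ℤ → A | TC.st L v t = TC.st L x' t} := by
      have hc : Continuous fun v : ℤ → A => TC.st L v t :=
        continuous_pi fun j => continuous_apply _
      exact (isOpen_discrete {TC.st L x' t}).preimage hc
    obtain ⟨v, hv, hv'⟩ := mem_closure_iff.1 hx' _ hopen rfl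
    exact ⟨v, hv', hv⟩
  refine isClosed_of_closure_subset fun x' hx' => ?_
  have hx'F : x' ∈ TC.Fib G := by
    intro t
    obtain ⟨v, ⟨hv1, hv2, _⟩, hv⟩ := near x' hx' t
    rw [← hv]
    exact (hF v).2 ⟨hv1, hv2.trans hxy⟩ t
  obtain ⟨hX', hy'⟩ := (hF x').1 hx'F
  obtain ⟨v, ⟨hv1, hv2, hv3, hv4⟩, hv⟩ := near x' hx' 0
  have hvF : v ∈ TC.Fib G := (hF v).2 ⟨hv1, hv2.trans hxy⟩
  refine ⟨hX', hy'.trans hxy.symm, (hTr _ _ hxy).2 ?_, (hTr _ _ hy').2 ?_⟩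
  · exact ((hTr _ _ hxy).1 hv3).trans (TC.share hR hvF hx'F 0 hv)
  · exact (TC.share hR hx'F hvF 0 hv.symm).trans ((hTr _ _ (hv2.trans hxy)).1 hv4)
end
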